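/- arXiv:1402.1101 — 2 statements merged into one kernel-verified Lean document; each statement's English description precedes it below -/
import Mathlib

section
/- For every natural number m, every group homomorphism from the Cremona group Cr(2) to GL_m(ℂ) is trivial; that is, Cr(2) admits no non-trivial finite-dimensional complex representation. -/
open scoped MatrixGroups

noncomputable section

/-- The Cremona group `Cr(n)`: the group of `ℂ`-algebra automorphisms of the rational
function field `ℂ(x₁,…,xₙ)`, i.e. of the field of fractions of `ℂ[x₁,…,xₙ]`. -/
abbrev Cr (n : ℕ) : Type :=
  FractionRing (MvPolynomial (Fin n) ℂ) ≃ₐ[ℂ] FractionRing (MvPolynomial (Fin n) ℂ)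

section

theorem eigenvalue_eq_one_of_mul_eq {V : Type*} [AddCommGroup V] [Module ℂ V]
    [FiniteDimensional ℂ V] {p : ℕ} (hp : p.Prime) (hV : Module.finrank ℂ V < p)
    {A B C : Module.End ℂ V} (hA : Function.Injective A) (hB : Function.Injective B)
    (hAB : A * B = C * B * A) (hCA : Commute C A) (hCB : Commute C B) (hC : C ^ p = 1)
    {ω : ℂ} (hω : C.HasEigenvalue ω) : ω = 1 := by
  set W := C.eigenspace ω with hW
  have hAW : ∀ v ∈ W, A v ∈ W := fun v hv =>
    Module.End.mapsTo_genEigenspace_of_comm hCA ω 1 hv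
  have hBW : ∀ v ∈ W, B v ∈ W := fun v hv =>
    Module.End.mapsTo_genEigenspace_of_comm hCB ω 1 hv
  have hd : 0 < Module.finrank ℂ W := by
    have : Nontrivial W := Submodule.nontrivial_iff_ne_bot.2 hω
    exact Module.finrank_pos
  have hdp : Module.finrank ℂ W < p := (Submodule.finrank_le W).trans_lt hV
  have hne : ∀ (T : Module.End ℂ V) (hT : ∀ v ∈ W, T v ∈ W), Function.Injective T →
      LinearMap.det (T.restrict hT) ≠ 0 := by
    intro T hT hinj h0
    have := LinearMap.bot_lt_ker_of_det_eq_zero h0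
    refine this.ne' (LinearMap.ker_eq_bot.2 fun a b hab => ?_)
    exact Subtype.ext (hinj (congrArg Subtype.val hab))
  have hmul : A.restrict hAW * B.restrict hBW = ω • (B.restrict hBW * A.restrict hAW) := by
    ext v
    have h1 : A (B v) = C (B (A v)) := by
      simpa using congrArg (fun T => T (v : V)) hAB
    have h2 := Module.End.mem_eigenspace_iff.1 (hBW _ (hAW _ v.2))
    simpa [h2] using h1
  have hdet := congrArg LinearMap.det hmul
  rw [LinearMap.det_smul, map_mul, map_mul] at hdet
  have h1 : ω ^ Module.finrank ℂ W = 1 := by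
    have := mul_ne_zero (hne B hBW hB) (hne A hAW hA)
    apply mul_right_cancel₀ this
    rw [← hdet, one_mul, mul_comm]
  have h2 : ω ^ p = 1 := by
    obtain ⟨v, hv⟩ := hω.exists_hasEigenvector
    have := hv.pow_apply p
    rw [hC] at this
    have h3 : (ω ^ p - 1) • v = 0 := by
      rw [sub_smul, ← this]; simp
    rcases smul_eq_zero.1 h3 with h | h
    · exact sub_eq_zero.1 h
    · exact absurd h hv.2
  have hco : Nat.Coprime (Module.finrank ℂ W) p :=
    (Nat.coprime_of_lt_prime hd.ne' hdp hp).symm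
  have := pow_gcd_eq_one.2 ⟨h1, h2⟩
  rwa [hco, pow_one] at this

theorem end_eq_one_of_mul_eq {V : Type*} [AddCommGroup V] [Module ℂ V]
    [FiniteDimensional ℂ V] {p : ℕ} (hp : p.Prime) (hV : Module.finrank ℂ V < p)
    {A B C : Module.End ℂ V} (hA : Function.Injective A) (hB : Function.Injective B)
    (hAB : A * B = C * B * A) (hCA : Commute C A) (hCB : Commute C B) (hC : C ^ p = 1) :
    C = 1 := by
  have hss : C.IsSemisimple := by
    refine Module.End.isSemisimple_of_squarefree_aeval_eq_zero
      (p := (Polynomial.X ^ p - 1 : Polynomial ℂ)) ?_ (by simp [hC])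
    exact (Polynomial.X_pow_sub_one_separable_iff.2 (by exact_mod_cast hp.ne_zero)).squarefree
  have htop := Module.End.iSup_maxGenEigenspace_eq_top C
  have h1 : C.eigenspace 1 = ⊤ := by
    rw [eq_top_iff, ← htop]
    refine iSup_le fun μ => ?_
    rw [hss.isFinitelySemisimple.maxGenEigenspace_eq_eigenspace]
    by_cases hμ : C.HasEigenvalue μ
    · rw [eigenvalue_eq_one_of_mul_eq hp hV hA hB hAB hCA hCB hC hμ]
    · rw [Module.End.hasEigenvalue_iff, not_not] at hμ
      simp [hμ]
  ext v
  have : v ∈ C.eigenspace 1 := h1 ▸ Submodule.mem_top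
  simpa using Module.End.mem_eigenspace_iff.1 this

theorem GL_eq_one_of_mul_eq {m p : ℕ} (hp : p.Prime) (hm : m < p) {A B C : GL (Fin m) ℂ}
    (hAB : A * B = C * B * A) (hCA : Commute C A) (hCB : Commute C B) (hC : C ^ p = 1) :
    C = 1 := by
  let φ := (Matrix.toLinAlgEquiv' (R := ℂ) (n := Fin m))
  have hinj : ∀ D : GL (Fin m) ℂ, Function.Injective (φ D.1) := by
    intro D
    have : Function.LeftInverse (φ D⁻¹.1) (φ D.1) := by
      intro v
      rw [← Module.End.mul_apply, ← map_mul, ← Units.val_mul]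
      simp
    exact this.injective
  have h := end_eq_one_of_mul_eq (A := φ A.1) (B := φ B.1) (C := φ C.1) hp
    (by simpa using hm) (hinj A) (hinj B)
    (by rw [← map_mul, ← map_mul, ← map_mul]; exact congrArg (fun D => φ D.1) hAB)
    (by simpa using (hCA.map (Units.coeHom _)).map φ)
    (by simpa using (hCB.map (Units.coeHom _)).map φ)
    (by rw [← map_pow, ← Units.val_pow_eq_pow_val, hC]; simp)
  apply Units.ext
  apply φ.injective
  simpa using h

end

section

variable {K : Type} [Field K] [Algebra ℂ K]

open IntermediateField in
/-- `x, y` is a system of coordinates of the purely transcendental extension `K = ℂ(x, y)`. -/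
structure IsCoord (x y : K) : Prop where
  indep : AlgebraicIndependent ℂ ![x, y]
  top : adjoin ℂ {x, y} = ⊤

namespace IsCoord

open IntermediateField

variable {x y x' y' : K}

theorem symm (h : IsCoord x y) : IsCoord y x := by
  refine ⟨?_, by rw [Set.pair_comm]; exact h.top⟩
  have := h.indep.comp ![1, 0] (by decide)
  convert this using 1
  ext i; fin_cases i <;> rfl

theorem isAlgebraic_of_top (h : adjoin ℂ {x, y} = ⊤) :
    Algebra.IsAlgebraic (Algebra.adjoin ℂ (Set.range ![x, y])) K := by
  rw [← isAlgebraic_adjoin_iff_top, Matrix.range_cons_cons_empty, h]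
  exact ⟨fun a => isAlgebraic_algebraMap (⟨a, mem_top⟩ : (⊤ : IntermediateField ℂ K))⟩

theorem trdeg_eq (h : IsCoord x y) : Algebra.trdeg ℂ K = 2 := by
  have : IsTranscendenceBasis ℂ ![x, y] :=
    h.indep.isTranscendenceBasis_iff_isAlgebraic.2 (isAlgebraic_of_top h.top)
  simpa using this.cardinalMk_eq_trdeg.symm

/-- Two elements generating `K` over `ℂ` are coordinates as soon as `K` has coordinates. -/
theorem of_mem (h : IsCoord x y) (hx : x ∈ adjoin ℂ {x', y'}) (hy : y ∈ adjoin ℂ {x', y'}) :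
    IsCoord x' y' := by
  have htop : adjoin ℂ {x', y'} = ⊤ := by
    rw [eq_top_iff, ← h.top, adjoin_le_iff]
    rintro z (rfl | rfl) <;> assumption
  have := isAlgebraic_of_top htop
  refine ⟨?_, htop⟩
  exact (Algebra.IsAlgebraic.isTranscendenceBasis_of_le_trdeg_of_finite ℂ ![x', y']
    (by simp [h.trdeg_eq])).1

theorem map (h : IsCoord x y) (σ : K ≃ₐ[ℂ] K) : IsCoord (σ x) (σ y) := by
  constructor
  · have := h.indep.map' (f := (σ : K →ₐ[ℂ] K)) σ.injective
    convert this using 1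
    ext i; fin_cases i <;> rfl
  · have := congrArg (IntermediateField.map (σ : K →ₐ[ℂ] K)) h.top
    rw [adjoin_map] at this
    simpa [Set.image_pair, ← AlgHom.fieldRange_eq_map, AlgEquiv.fieldRange_eq_top] using this

theorem equiv_ext (h : IsCoord x y) {σ τ : K ≃ₐ[ℂ] K} (hx : σ x = τ x) (hy : σ y = τ y) :
    σ = τ := by
  ext z
  have hz : z ∈ adjoin ℂ {x, y} := h.top ▸ mem_top
  induction hz using adjoin_induction with
  | mem z hz => rcases hz with rfl | rfl <;> assumption
  | algebraMap z => simp
  | add a b _ _ ha hb => simp [ha, hb]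
  | inv a _ ha => simp [ha]
  | mul a b _ _ ha hb => simp [ha, hb]

theorem exists_equiv (h : IsCoord x y) (h' : IsCoord x' y') :
    ∃ σ : K ≃ₐ[ℂ] K, σ x = x' ∧ σ y = y' := by
  have aux : ∀ {x y : K}, IsCoord x y → ∃ e : FractionRing (MvPolynomial (Fin 2) ℂ) ≃ₐ[ℂ] K,
      e (algebraMap (MvPolynomial (Fin 2) ℂ) _ (MvPolynomial.X 0)) = x ∧
      e (algebraMap (MvPolynomial (Fin 2) ℂ) _ (MvPolynomial.X 1)) = y := by
    intro x y h
    have ht : adjoin ℂ (Set.range ![x, y]) = ⊤ := by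
      rw [Matrix.range_cons_cons_empty, h.top]
    refine ⟨h.indep.aevalEquivField.trans ((equivOfEq ht).trans topEquiv), ?_, ?_⟩
    · simp
    · simp
  obtain ⟨e, h0, h1⟩ := aux h
  obtain ⟨e', h0', h1'⟩ := aux h'
  refine ⟨e.symm.trans e', ?_, ?_⟩
  · rw [← h0', AlgEquiv.trans_apply, ← h0, e.symm_apply_apply]
  · rw [← h1', AlgEquiv.trans_apply, ← h1, e.symm_apply_apply]

theorem transcendental_right (h : IsCoord x y) : Transcendental ℂ⟮x⟯ y := by
  have := (h.indep.transcendental_adjoin (s := {0}) (i := 1) (by simp))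
  rw [Transcendental, ← isAlgebraic_adjoin_iff, Set.image_singleton] at this
  exact this

theorem adjoin_right (h : IsCoord x y) : ℂ⟮x⟯⟮y⟯ = ⊤ := by
  apply restrictScalars_injective ℂ
  rw [adjoin_simple_adjoin_simple, h.top, restrictScalars_top]

theorem ne_zero_right (h : IsCoord x y) : y ≠ 0 := fun h0 =>
  h.transcendental_right (h0 ▸ isAlgebraic_zero)

theorem ne_zero_left (h : IsCoord x y) : x ≠ 0 := h.symm.ne_zero_right

theorem transcendental_left (h : IsCoord x y) : Transcendental ℂ x :=
  h.indep.transcendental 0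

theorem mem_left {a : K} (ha : a ∈ ℂ⟮x⟯) : a ∈ adjoin ℂ {x, y} :=
  adjoin.mono _ _ _ (by simp) ha

theorem mul (h : IsCoord x y) {a : K} (ha : a ∈ ℂ⟮x⟯) (h0 : a ≠ 0) : IsCoord x (a * y) := by
  refine h.of_mem (mem_adjoin_pair_left _ _ _) ?_
  have : y = a⁻¹ * (a * y) := by field_simp
  exact (congrArg (· ∈ ℂ⟮x, a * y⟯) this).mpr
    (mul_mem (inv_mem (mem_left ha)) (mem_adjoin_pair_right _ _ _))

theorem add (h : IsCoord x y) {a : K} (ha : a ∈ ℂ⟮x⟯) : IsCoord x (y + a) := by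
  refine h.of_mem (mem_adjoin_pair_left _ _ _) ?_
  have : y = (y + a) - a := by ring
  exact (congrArg (· ∈ ℂ⟮x, y + a⟯) this).mpr
    (sub_mem (mem_adjoin_pair_right _ _ _) (mem_left ha))

theorem inv (h : IsCoord x y) : IsCoord x y⁻¹ := by
  refine h.of_mem (mem_adjoin_pair_left _ _ _) ?_
  simpa using inv_mem (mem_adjoin_pair_right ℂ x y⁻¹)

theorem fixes {σ : K ≃ₐ[ℂ] K} (hσ : σ x = x) {a : K} (ha : a ∈ ℂ⟮x⟯) : σ a = a := by
  induction ha using adjoin_induction with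
  | mem z hz => rw [Set.mem_singleton_iff.1 hz]; exact hσ
  | algebraMap z => simp
  | add a b _ _ ha hb => simp [ha, hb]
  | inv a _ ha => simp [ha]
  | mul a b _ _ ha hb => simp [ha, hb]

end IsCoord

theorem isCoord_X : IsCoord
    (algebraMap (MvPolynomial (Fin 2) ℂ) (FractionRing (MvPolynomial (Fin 2) ℂ))
      (MvPolynomial.X 0))
    (algebraMap (MvPolynomial (Fin 2) ℂ) (FractionRing (MvPolynomial (Fin 2) ℂ))
      (MvPolynomial.X 1)) := by
  constructor
  · have := (MvPolynomial.algebraicIndependent_X (Fin 2) ℂ).map'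
      (f := Algebra.algHom ℂ _ (FractionRing (MvPolynomial (Fin 2) ℂ)))
      (IsFractionRing.injective _ _)
    have h2 : ![algebraMap (MvPolynomial (Fin 2) ℂ) (FractionRing (MvPolynomial (Fin 2) ℂ))
        (MvPolynomial.X 0), algebraMap (MvPolynomial (Fin 2) ℂ)
        (FractionRing (MvPolynomial (Fin 2) ℂ)) (MvPolynomial.X 1)] =
        Algebra.algHom ℂ _ (FractionRing (MvPolynomial (Fin 2) ℂ)) ∘
        (MvPolynomial.X : Fin 2 → MvPolynomial (Fin 2) ℂ) := by
      ext i; fin_cases i <;> rfl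
    rw [h2]
    exact this
  · rw [eq_top_iff]
    intro z _
    have key : ∀ p : MvPolynomial (Fin 2) ℂ,
        algebraMap _ (FractionRing (MvPolynomial (Fin 2) ℂ)) p ∈ IntermediateField.adjoin ℂ
        {algebraMap (MvPolynomial (Fin 2) ℂ) (FractionRing (MvPolynomial (Fin 2) ℂ))
          (MvPolynomial.X 0), algebraMap (MvPolynomial (Fin 2) ℂ) _ (MvPolynomial.X 1)} := by
      intro p
      induction p using MvPolynomial.induction_on with
      | C a =>
        exact IntermediateField.algebraMap_mem _ a
      | add p q hp hq => rw [map_add]; exact add_mem hp hq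
      | mul_X p i hp =>
        rw [map_mul]
        refine mul_mem hp (IntermediateField.subset_adjoin _ _ ?_)
        fin_cases i <;> simp
    obtain ⟨p, q, -, rfl⟩ := IsFractionRing.div_surjective (A := MvPolynomial (Fin 2) ℂ) z
    exact div_mem (key p) (key q)

end

section

variable {K : Type} [Field K] [Algebra ℂ K]

open IntermediateField in
/-- A family of coordinate systems stable under the elementary birational changes of
coordinates. -/
structure MoveClosed (P : K → K → Prop) : Prop where
  coord : ∀ {x y}, P x y → IsCoord x y
  swap : ∀ {x y}, P x y → P y x
  inv : ∀ {x y}, P x y → P x y⁻¹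
  mul : ∀ {x y a}, P x y → a ∈ ℂ⟮x⟯ → a ≠ 0 → P x (a * y)
  add : ∀ {x y a}, P x y → a ∈ ℂ⟮x⟯ → P x (y + a)

/-- Two coordinate systems are related if an element of `N` maps one to the other. -/
def CoordRel (N : Subgroup (K ≃ₐ[ℂ] K)) (x y x' y' : K) : Prop :=
  ∃ σ ∈ N, σ x = x' ∧ σ y = y'

namespace CoordRel

open IntermediateField

variable {N : Subgroup (K ≃ₐ[ℂ] K)} {x y x' y' x'' y'' : K}

theorem trans (h : CoordRel N x y x' y') (h' : CoordRel N x' y' x'' y'') :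
    CoordRel N x y x'' y'' := by
  obtain ⟨σ, hσ, rfl, rfl⟩ := h
  obtain ⟨τ, hτ, rfl, rfl⟩ := h'
  exact ⟨τ * σ, mul_mem hτ hσ, rfl, rfl⟩

theorem symm (h : CoordRel N x y x' y') : CoordRel N x' y' x y := by
  obtain ⟨σ, hσ, rfl, rfl⟩ := h
  exact ⟨σ⁻¹, inv_mem hσ, σ.symm_apply_apply x, σ.symm_apply_apply y⟩

theorem swap (h : CoordRel N x y x' y') : CoordRel N y x y' x' := by
  obtain ⟨σ, hσ, h1, h2⟩ := h
  exact ⟨σ, hσ, h2, h1⟩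

/-- `N` contains a nontrivial scaling of the second coordinate, in every coordinate system. -/
def HasScaling (N : Subgroup (K ≃ₐ[ℂ] K)) : Prop :=
  ∃ ζ : ℂ, ζ ≠ 0 ∧ ζ ≠ 1 ∧ ∀ x y : K, IsCoord x y → CoordRel N x y x (algebraMap ℂ K ζ * y)

theorem add_right (hN : HasScaling N) (h : IsCoord x y) {a : K} (ha : a ∈ ℂ⟮x⟯) :
    CoordRel N x y x (y + a) := by
  obtain ⟨ζ, h0, h1, hζ⟩ := hN
  have e0 : algebraMap ℂ K ζ ≠ 0 := by simpa using h0
  have e1 : algebraMap ℂ K ζ - 1 ≠ 0 := by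
    rw [sub_ne_zero]; simpa using h1
  set z := algebraMap ℂ K ζ with hz
  have hzm : z ∈ ℂ⟮x⟯ := IntermediateField.algebraMap_mem _ _
  have hb : a / (z - 1) ∈ ℂ⟮x⟯ := div_mem ha (sub_mem hzm (one_mem _))
  have hc := h.mul (inv_mem hzm) (inv_ne_zero e0)
  obtain ⟨σ, hσ, hx, hy⟩ := hζ x _ (hc.add hb)
  have hσ2 : σ (z⁻¹ * y) = y + a := by
    rw [map_add, IsCoord.fixes hx hb] at hy
    rw [eq_sub_of_add_eq hy]
    field_simp
    ring
  refine symm (trans (symm ⟨σ, hσ, hx, hσ2⟩) ?_)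
  have := hζ x _ hc
  rwa [← mul_assoc, mul_inv_cancel₀ e0, one_mul] at this

theorem lower (hN : HasScaling N) (h : IsCoord x y) {a : K} (ha : a ∈ ℂ⟮x⟯) :
    CoordRel N x y x (y⁻¹ + a)⁻¹ := by
  obtain ⟨σ, hσ, hx, hy⟩ := add_right hN h.inv ha
  refine ⟨σ, hσ, hx, ?_⟩
  rw [← hy, map_inv₀, inv_inv]

theorem neg_sq_div (hN : HasScaling N) (h : IsCoord x y) {a : K} (ha : a ∈ ℂ⟮x⟯) (h0 : a ≠ 0) :
    CoordRel N x y x (-a ^ 2 * y⁻¹) := by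
  have hya := h.add ha
  have e1 := add_right hN h ha
  have e2 := lower hN hya (a := -a⁻¹) (neg_mem (inv_mem ha))
  obtain ⟨τ, -, hx, hy⟩ := e2
  have hc : IsCoord x ((y + a)⁻¹ + -a⁻¹)⁻¹ := (hya.inv.add (neg_mem (inv_mem ha))).inv
  have e3 := add_right hN hc ha
  have hy0 := h.ne_zero_right
  have hya0 := hya.ne_zero_right
  refine trans e1 (trans (lower hN hya (a := -a⁻¹) (neg_mem (inv_mem ha))) ?_)
  convert e3 using 1
  have : (y + a)⁻¹ + -a⁻¹ = -y / (a * (y + a)) := by field_simp; ring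
  rw [this]
  field_simp
  ring

theorem inv_right (hN : HasScaling N) (h : IsCoord x y) : CoordRel N x y x y⁻¹ := by
  have := neg_sq_div hN h (a := algebraMap ℂ K Complex.I) (IntermediateField.algebraMap_mem _ _)
    (by simp)
  rwa [← map_pow, Complex.I_sq, map_neg, neg_neg, map_one, one_mul] at this

theorem const_mul_right (hN : HasScaling N) (h : IsCoord x y) {c : ℂ} (hc : c ≠ 0) :
    CoordRel N x y x (algebraMap ℂ K c * y) := by
  obtain ⟨b, hb⟩ := IsAlgClosed.exists_pow_nat_eq (-c) (n := 2) (by norm_num)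
  have hb0 : b ≠ 0 := by rintro rfl; simp at hb; exact hc hb
  refine trans (inv_right hN h) ?_
  have := neg_sq_div hN h.inv (a := algebraMap ℂ K b) (IntermediateField.algebraMap_mem _ _)
    (by simpa)
  rwa [← map_pow, hb, map_neg, neg_neg, inv_inv] at this

theorem swap_coord (hN : HasScaling N) (h : IsCoord x y) : CoordRel N x y y x := by
  have h1 : IsCoord y (x + y) := h.symm.add (mem_adjoin_simple_self ℂ y)
  have e1 : CoordRel N x y (x + y) y := (add_right hN h.symm (mem_adjoin_simple_self ℂ y)).swap
  have h2 : IsCoord (x + y) (y + -(x + y)) := h1.symm.add (neg_mem (mem_adjoin_simple_self ℂ _))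
  have e2 := add_right hN h1.symm (neg_mem (mem_adjoin_simple_self ℂ (x + y)))
  have e3 := (add_right hN h2.symm (mem_adjoin_simple_self ℂ (y + -(x + y)))).swap
  have h3 := (h2.symm.add (mem_adjoin_simple_self ℂ (y + -(x + y)))).symm
  have e4 := const_mul_right hN h3 (c := -1) (by simp)
  convert trans e1 (trans e2 (trans e3 e4)) using 1
  · ring
  · simp

theorem self_div (hN : HasScaling N) (h : IsCoord x y) : CoordRel N x y x (x * y⁻¹) := by
  have h0 := h.ne_zero_right
  have hc : IsCoord y (x * y⁻¹) := by
    refine h.of_mem ?_ (mem_adjoin_pair_left _ _ _)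
    have := mul_mem (mem_adjoin_pair_left ℂ y (x * y⁻¹)) (mem_adjoin_pair_right ℂ y (x * y⁻¹))
    exact (congrArg (· ∈ ℂ⟮y, x * y⁻¹⟯) (by field_simp)).mp this
  obtain ⟨σ, hσ, h1, h2⟩ := swap_coord hN hc
  have hσx : σ x = x := by
    have : x = y * (x * y⁻¹) := by field_simp
    conv_lhs => rw [this]
    rw [map_mul, h1, h2, mul_comm, ← this]
  exact ⟨σ, hσ, hσx, h1⟩

theorem self_mul_right (hN : HasScaling N) (h : IsCoord x y) : CoordRel N x y x (x * y) := by
  have hx := h.mul (mem_adjoin_simple_self ℂ x) h.ne_zero_left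
  have e := inv_right hN (h.inv.mul (mem_adjoin_simple_self ℂ x) h.ne_zero_left)
  refine trans (inv_right hN h) ?_
  convert self_div hN h.inv using 1
  rw [inv_inv]

theorem mul_right (hN : HasScaling N) (h : IsCoord x y) {a : K} (ha : a ∈ ℂ⟮x⟯) (h0 : a ≠ 0) :
    CoordRel N x y x (a * y) := by
  have key : ∀ p : Polynomial ℂ, p ≠ 0 → ∀ y, IsCoord x y →
      CoordRel N x y x (Polynomial.aeval x p * y) ∧ Polynomial.aeval x p ≠ 0 := by
    intro p
    have hs := IsAlgClosed.splits p
    induction hs using Submonoid.closure_induction with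
    | mem q hq =>
      intro _ y h
      rcases hq with ⟨c, rfl⟩ | ⟨c, rfl⟩
      · have hc : c ≠ 0 := by rintro rfl; simp at *
        simpa [hc] using const_mul_right hN h hc
      · have hc : IsCoord (x + algebraMap ℂ K c) y :=
          (h.symm.add (IntermediateField.algebraMap_mem _ _)).symm
        obtain ⟨σ, hσ, h1, h2⟩ := self_mul_right hN hc
        refine ⟨⟨σ, hσ, ?_, by simpa using h2⟩, by simpa using hc.ne_zero_left⟩
        simpa using h1
    | one => intro _ y h; simpa using ⟨1, one_mem _, rfl, rfl⟩
    | mul p q _ _ hp hq =>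
      intro hpq y h
      obtain ⟨e1, n1⟩ := hp (left_ne_zero_of_mul hpq) y h
      have hm : Polynomial.aeval x p ∈ ℂ⟮x⟯ :=
        (mem_adjoin_simple_iff ℂ _).2 ⟨p, 1, by simp⟩
      obtain ⟨e2, n2⟩ := hq (right_ne_zero_of_mul hpq) _ (h.mul hm n1)
      rw [map_mul]
      refine ⟨?_, mul_ne_zero n1 n2⟩
      convert trans e1 e2 using 1
      ring
  obtain ⟨p, q, rfl⟩ := (mem_adjoin_simple_iff ℂ _).1 ha
  have hp : p ≠ 0 := by rintro rfl; simp at h0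
  have hq : q ≠ 0 := by rintro rfl; simp at h0
  have hm : (Polynomial.aeval x q)⁻¹ ∈ ℂ⟮x⟯ :=
    (mem_adjoin_simple_iff ℂ _).2 ⟨1, q, by simp⟩
  have nq := (key q hq y h).2
  have hc := h.mul hm (inv_ne_zero nq)
  have e1 := (key q hq _ hc).1
  rw [mul_inv_cancel_left₀ nq] at e1
  convert trans e1.symm (key p hp _ hc).1 using 1
  field_simp

theorem moveClosed (hN : HasScaling N) :
    MoveClosed fun x' y' => IsCoord x' y' ∧ CoordRel N x y x' y' where
  coord h := h.1
  swap h := ⟨h.1.symm, trans h.2 (swap_coord hN h.1)⟩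
  inv h := ⟨h.1.inv, trans h.2 (inv_right hN h.1)⟩
  mul h ha h0 := ⟨h.1.mul ha h0, trans h.2 (mul_right hN h.1 ha h0)⟩
  add h ha := ⟨h.1.add ha, trans h.2 (add_right hN h.1 ha)⟩

theorem hasScaling_ker {m : ℕ} (ρ : (K ≃ₐ[ℂ] K) →* GL (Fin m) ℂ) : HasScaling ρ.ker := by
  obtain ⟨p, hmp, hp⟩ := Nat.exists_infinite_primes (m + 2)
  have hζ := Complex.isPrimitiveRoot_exp p hp.ne_zero
  set ζ := Complex.exp (2 * Real.pi * Complex.I / p) with hζ'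
  have hζ0 : ζ ≠ 0 := Complex.exp_ne_zero _
  have e0 : algebraMap ℂ K ζ ≠ 0 := by simpa
  refine ⟨ζ, hζ0, hζ.ne_one hp.one_lt, fun x y h => ?_⟩
  have hm : ∀ z : K, algebraMap ℂ K ζ ∈ ℂ⟮z⟯ := fun z => IntermediateField.algebraMap_mem _ _
  obtain ⟨C, hCx, hCy⟩ := h.exists_equiv (h.mul (hm x) e0)
  obtain ⟨A, hAx, hAy⟩ := h.exists_equiv (h.symm.mul (hm y) e0).symm
  obtain ⟨B, hBx, hBy⟩ := h.exists_equiv (h.mul (mem_adjoin_simple_self ℂ x) h.ne_zero_left)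
  refine ⟨C, ?_, hCx, hCy⟩
  rw [MonoidHom.mem_ker]
  have hCp : ∀ n, (C ^ n) x = x ∧ (C ^ n) y = algebraMap ℂ K (ζ ^ n) * y := by
    intro n
    induction n with
    | zero => simp
    | succ n ih =>
      simp only [pow_succ, AlgEquiv.mul_apply, hCx, hCy, map_mul, ih, AlgEquiv.commutes, true_and]
      ring
  refine GL_eq_one_of_mul_eq (A := ρ A) (B := ρ B) (p := p) hp (by omega) ?_ ?_ ?_ ?_
  · rw [← map_mul, ← map_mul, ← map_mul]
    congr 1
    exact h.equiv_ext (by simp [hCx, hAx, hBx]) (by simp [hCx, hCy, hAx, hAy, hBy]; ring)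
  · refine Commute.map ?_ ρ
    exact h.equiv_ext (by simp [hCx, hAx]) (by simp [hCy, hAy])
  · refine Commute.map ?_ ρ
    exact h.equiv_ext (by simp [hCx, hBx]) (by simp [hCx, hCy, hBy]; ring)
  · rw [← map_pow, ← map_one ρ]
    congr 1
    refine h.equiv_ext ?_ ?_ <;> simp [hCp, hζ.pow_eq_one]

end CoordRel

end

section

section Moebius

open IntermediateField Polynomial

variable {F L : Type*} [Field F] [Field L] [Algebra F L]

theorem exists_ratFunc_algHom {t : L} (ht : Transcendental F t) :
    ∃ φ : RatFunc F →ₐ[F] L, φ RatFunc.X = t ∧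
      ∀ p : F[X], φ (algebraMap F[X] (RatFunc F) p) = aeval t p := by
  have hinj : Function.Injective (aeval t : F[X] →ₐ[F] L) :=
    transcendental_iff_injective.1 ht
  have h2 : ∀ p : F[X], (IsFractionRing.liftAlgHom (K := RatFunc F)
      (g := (aeval t : F[X] →ₐ[F] L)) hinj) (algebraMap F[X] (RatFunc F) p) = aeval t p := by
    simp
  refine ⟨IsFractionRing.liftAlgHom (K := RatFunc F) (g := (aeval t : F[X] →ₐ[F] L)) hinj, ?_, h2⟩
  rw [← RatFunc.algebraMap_X, h2, aeval_X]

/-- A generator of a simple transcendental extension is obtained from another one by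
elementary moves. -/
theorem generator_induction {Q : L → Prop} (hinv : ∀ t, Q t → Q t⁻¹)
    (hmul : ∀ (t : L) (a : F), a ≠ 0 → Q t → Q (algebraMap F L a * t))
    (hadd : ∀ (t : L) (a : F), Q t → Q (t + algebraMap F L a)) {s t : L}
    (ht : Transcendental F t) (hs : s ∈ F⟮t⟯) (hts : t ∈ F⟮s⟯) (hQ : Q t) : Q s := by
  obtain ⟨φ, hφ, hφp⟩ := exists_ratFunc_algHom ht
  obtain ⟨p, q, hpq⟩ := (mem_adjoin_simple_iff F s).1 hs
  set f : RatFunc F := algebraMap F[X] (RatFunc F) p / algebraMap F[X] (RatFunc F) q with hf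
  have hfs : φ f = s := by rw [hf, map_div₀, hφp, hφp, hpq]
  have htop : F⟮f⟯ = ⊤ := by
    obtain ⟨p', q', hpq'⟩ := (mem_adjoin_simple_iff F t).1 hts
    rw [eq_top_iff, ← RatFunc.adjoin_X, adjoin_simple_le_iff, mem_adjoin_simple_iff]
    refine ⟨p', q', φ.injective ?_⟩
    change φ _ = φ _
    rw [hφ, map_div₀, ← aeval_algHom_apply, ← aeval_algHom_apply, hfs, hpq']
  have hdeg := RatFunc.finrank_eq_max_natDegree f
  rw [htop, IntermediateField.finrank_top] at hdeg
  have hnum := eq_X_add_C_of_natDegree_le_one (p := f.num) (hdeg ▸ le_max_left _ _)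
  have hden := eq_X_add_C_of_natDegree_le_one (p := f.denom) (hdeg ▸ le_max_right _ _)
  generalize f.num.coeff 1 = a, f.num.coeff 0 = b at hnum
  generalize f.denom.coeff 1 = c, f.denom.coeff 0 = d at hden
  have hst : s = (algebraMap F L a * t + algebraMap F L b) /
      (algebraMap F L c * t + algebraMap F L d) := by
    rw [← hfs, ← RatFunc.num_div_denom f, map_div₀, hφp, hφp, hnum, hden]
    simp
  have hs0 : ∀ e : F, s ≠ algebraMap F L e := by
    rintro e rfl
    have : F⟮algebraMap F L e⟯ = ⊥ :=
      adjoin_simple_eq_bot_iff.2 (IntermediateField.algebraMap_mem _ _)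
    rw [this, mem_bot] at hts
    obtain ⟨e', rfl⟩ := hts
    exact ht (isAlgebraic_algebraMap e')
  have ht0 : ∀ e e' : F, e ≠ 0 → algebraMap F L e * t + algebraMap F L e' ≠ 0 := by
    intro e e' he h
    have he : algebraMap F L e ≠ 0 := by simpa
    refine ht ?_
    rw [show t = algebraMap F L (-e' / e) by
      rw [map_div₀, map_neg, eq_div_iff he]; linear_combination h]
    exact isAlgebraic_algebraMap _
  by_cases hc : c = 0
  · subst hc
    rw [map_zero, zero_mul, zero_add] at hst
    have hs1 := hs0 0
    have hd : d ≠ 0 := by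
      rintro rfl
      simp [hst] at hs1
    have ha : a ≠ 0 := by
      rintro rfl
      refine hs0 (b / d) ?_
      simp [hst]
    have := hadd _ (b / d) (hmul t (a / d) (div_ne_zero ha hd) hQ)
    have hd' : algebraMap F L d ≠ 0 := by simpa
    convert this using 1
    rw [hst, map_div₀, map_div₀]
    field_simp
  · have hc' : algebraMap F L c ≠ 0 := by simpa
    have hn := ht0 c d hc
    have hs : s = algebraMap F L ((b * c - a * d) / c) *
        (algebraMap F L c * t + algebraMap F L d)⁻¹ + algebraMap F L (a / c) := by
      rw [hst]
      simp only [map_div₀, map_sub, map_mul]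
      rw [div_eq_iff hn, add_mul, inv_mul_cancel_right₀ hn]
      field_simp
      ring
    have he : (b * c - a * d) / c ≠ 0 := by
      intro h
      rw [h] at hs
      simp only [map_zero, zero_mul, zero_add] at hs
      exact hs0 _ hs
    rw [hs]
    exact hadd _ _ (hmul _ _ he (hinv _ (hadd _ _ (hmul _ _ hc hQ))))

/-- `F` is algebraically closed in a simple purely transcendental extension. -/
theorem mem_range_of_isAlgebraic {t : L} (ht : Transcendental F t) (htop : F⟮t⟯ = ⊤) {x : L}
    (hx : IsAlgebraic F x) : ∃ a : F, algebraMap F L a = x := by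
  obtain ⟨φ, hφ, hφp⟩ := exists_ratFunc_algHom ht
  obtain ⟨p, q, hpq⟩ := (mem_adjoin_simple_iff F x).1 (htop ▸ mem_top)
  set f : RatFunc F := algebraMap F[X] (RatFunc F) p / algebraMap F[X] (RatFunc F) q with hf
  have hfx : φ f = x := by rw [hf, map_div₀, hφp, hφp, hpq]
  rw [← hfx, isAlgebraic_algHom_iff φ φ.injective] at hx
  by_contra! hcon
  refine RatFunc.transcendental_of_ne_C f ?_ hx
  rintro ⟨c, hc⟩
  refine hcon c ?_
  rw [← hfx, hc, ← RatFunc.algebraMap_C, hφp, aeval_C]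

theorem isAlgebraic_of_mem_adjoin_simple {t u : L} (hu : Transcendental F u) (h : u ∈ F⟮t⟯) :
    IsAlgebraic F⟮u⟯ t := by
  obtain ⟨p, q, hpq⟩ := (mem_adjoin_simple_iff F u).1 h
  have hq : aeval t q ≠ 0 := by
    intro h0
    rw [h0, div_zero] at hpq
    exact hu (hpq ▸ isAlgebraic_zero)
  refine ⟨p.map (algebraMap F F⟮u⟯) - C (AdjoinSimple.gen F u) * q.map (algebraMap F F⟮u⟯), ?_, ?_⟩
  · intro h0
    have hq0 : q ≠ 0 := by rintro rfl; simp at hq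
    have := congrArg (fun r => algebraMap F⟮u⟯ L (r.coeff q.natDegree)) h0
    simp only [coeff_sub, coeff_map, coeff_C_mul, map_sub, map_mul, AdjoinSimple.algebraMap_gen,
      coeff_natDegree, coeff_zero, map_zero, ← IsScalarTower.algebraMap_apply] at this
    have hl : algebraMap F L q.leadingCoeff ≠ 0 := by simpa
    refine hu ?_
    rw [show u = algebraMap F L (p.coeff q.natDegree / q.leadingCoeff) by
      rw [map_div₀, eq_div_iff hl]; linear_combination -this]
    exact isAlgebraic_algebraMap _
  · simp only [map_sub, map_mul, aeval_C, AdjoinSimple.algebraMap_gen, aeval_map_algebraMap]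
    rw [hpq]
    field_simp
    simp

end Moebius

open IntermediateField in
theorem MoveClosed.of_mem_adjoin {K : Type} [Field K] [Algebra ℂ K] {P : K → K → Prop}
    (hP : MoveClosed P) {x y u v : K} (h : P x y) (huv : IsCoord u v) (hu : u ∈ ℂ⟮x⟯) :
    P u v := by
  have hxu : x ∈ ℂ⟮u⟯ := by
    obtain ⟨a, rfl⟩ := mem_range_of_isAlgebraic huv.transcendental_right huv.adjoin_right
      (isAlgebraic_of_mem_adjoin_simple huv.transcendental_left hu)
    exact a.2
  have h1 : P u y := by
    refine generator_induction (F := ℂ) (Q := fun t => P t y) ?_ ?_ ?_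
      (hP.coord h).transcendental_left hu hxu h
    · exact fun t ht => hP.swap (hP.inv (hP.swap ht))
    · exact fun t a ha ht =>
        hP.swap (hP.mul (hP.swap ht) (IntermediateField.algebraMap_mem _ _) (by simpa))
    · exact fun t a ht => hP.swap (hP.add (hP.swap ht) (IntermediateField.algebraMap_mem _ _))
  refine generator_induction (F := ℂ⟮u⟯) (Q := fun t => P u t) ?_ ?_ ?_
    (hP.coord h1).transcendental_right ?_ ?_ h1
  · exact fun t ht => hP.inv ht
  · exact fun t a ha ht => hP.mul ht a.2 (by simpa using ha)
  · exact fun t a ht => hP.add ht a.2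
  · rw [(hP.coord h1).adjoin_right]; exact mem_top
  · rw [huv.adjoin_right]; exact mem_top

end

section

/-- A derivation of a domain extends to its field of fractions. -/
theorem exists_derivation_fractionRing (R A : Type) [Field R] [CommRing A] [IsDomain A]
    [Algebra R A] (D : Derivation R A A) :
    ∃ D' : Derivation R (FractionRing A) (FractionRing A),
      ∀ a : A, D' (algebraMap A _ a) = algebraMap A _ (D a) := by
  let T := FractionRing A
  have : Algebra.FormallyEtale A T := Algebra.FormallyEtale.of_isLocalization (nonZeroDivisors A)
  let f : KaehlerDifferential R A →ₗ[A] T :=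
    (Algebra.linearMap A T).comp D.liftKaehlerDifferential
  let g : KaehlerDifferential R T →ₗ[T] T :=
    (f.liftBaseChange T).comp
      (KaehlerDifferential.tensorKaehlerEquivOfFormallyEtale R A T).symm.toLinearMap
  refine ⟨g.compDer (KaehlerDifferential.D R T), fun a => ?_⟩
  change g (KaehlerDifferential.D R T (algebraMap A T a)) = _
  simp only [g, LinearMap.comp_apply, LinearEquiv.coe_coe]
  rw [KaehlerDifferential.tensorKaehlerEquivOfFormallyEtale_symm_D_algebraMap]
  simp [f, LinearMap.liftBaseChange_tmul, Derivation.liftKaehlerDifferential_comp_D]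
  rfl

variable {K : Type} [Field K] [Algebra ℂ K]

/-- `d₁` and `d₂` are the partial derivatives with respect to the coordinates `u` and `v`. -/
structure IsPartials (u v : K) (d₁ d₂ : Derivation ℂ K K) : Prop where
  fst_fst : d₁ u = 1
  fst_snd : d₁ v = 0
  snd_fst : d₂ u = 0
  snd_snd : d₂ v = 1

theorem exists_isPartials_X : ∃ d₁ d₂, IsPartials
    (algebraMap (MvPolynomial (Fin 2) ℂ) (FractionRing (MvPolynomial (Fin 2) ℂ)) (MvPolynomial.X 0))
    (algebraMap (MvPolynomial (Fin 2) ℂ) (FractionRing (MvPolynomial (Fin 2) ℂ)) (MvPolynomial.X 1))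
    d₁ d₂ := by
  obtain ⟨d₁, h₁⟩ := exists_derivation_fractionRing ℂ (MvPolynomial (Fin 2) ℂ)
    (MvPolynomial.pderiv 0)
  obtain ⟨d₂, h₂⟩ := exists_derivation_fractionRing ℂ (MvPolynomial (Fin 2) ℂ)
    (MvPolynomial.pderiv 1)
  refine ⟨d₁, d₂, ?_, ?_, ?_, ?_⟩ <;> simp [h₁, h₂, MvPolynomial.pderiv_X]

namespace IsPartials

variable {u v : K} {d₁ d₂ : Derivation ℂ K K}

theorem inv (h : IsPartials u v d₁ d₂) (hv : v ≠ 0) :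
    IsPartials u v⁻¹ d₁ (-(v ^ 2) • d₂) := by
  refine ⟨h.fst_fst, ?_, ?_, ?_⟩
  · simp [Derivation.leibniz_inv, h.fst_snd]
  · simp [h.snd_fst]
  · simp [Derivation.leibniz_inv, h.snd_snd, hv]

end IsPartials

/-- The Jacobian determinant of `f` and `g`, as a derivation in `g`. -/
def jacobian (d₁ d₂ : Derivation ℂ K K) (f : K) : Derivation ℂ K K :=
  d₁ f • d₂ - d₂ f • d₁

section jacobian

variable (d₁ d₂ : Derivation ℂ K K) (f g : K)

theorem jacobian_apply : jacobian d₁ d₂ f g = d₁ f * d₂ g - d₂ f * d₁ g := rfl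

theorem jacobian_swap : jacobian d₁ d₂ f g = - jacobian d₁ d₂ g f := by
  simp only [jacobian_apply]; ring

theorem jacobian_self : jacobian d₁ d₂ f f = 0 := by
  simp only [jacobian_apply]; ring

theorem jacobian_smul_right (c : K) :
    jacobian d₁ (c • d₂) f g = c * jacobian d₁ d₂ f g := by
  simp only [jacobian_apply, Derivation.smul_apply, smul_eq_mul]; ring

end jacobian

open IntermediateField

theorem Derivation.eq_zero_on_adjoin {s : Set K} (d : Derivation ℂ K K) (hs : ∀ a ∈ s, d a = 0)
    {a : K} (ha : a ∈ adjoin ℂ s) : d a = 0 := by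
  induction ha using adjoin_induction with
  | mem x hx => exact hs x hx
  | algebraMap c => simp
  | add x y _ _ hx hy => simp [hx, hy]
  | inv x _ hx => simp [Derivation.leibniz_inv, hx]
  | mul x y _ _ hx hy => simp [hx, hy]

theorem IsCoord.jacobian_ne_zero {u v x y : K} {d₁ d₂ : Derivation ℂ K K}
    (hp : IsPartials u v d₁ d₂) (h : IsCoord x y) : jacobian d₁ d₂ x y ≠ 0 := by
  intro h0
  have h1 : ∀ a, jacobian d₁ d₂ x a = 0 := fun a =>
    Derivation.eq_zero_on_adjoin (s := {x, y}) _ (by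
      rintro a (rfl | rfl)
      · exact jacobian_self ..
      · exact h0) (h.top ▸ mem_top)
  have h2 : ∀ b, jacobian d₁ d₂ b x = 0 := fun b => by rw [jacobian_swap, h1, neg_zero]
  have e1 : d₁ x = 0 := by
    have := h1 v
    rwa [jacobian_apply, hp.fst_snd, hp.snd_snd, mul_one, mul_zero, sub_zero] at this
  have e2 : d₂ x = 0 := by
    have := h1 u
    rwa [jacobian_apply, hp.fst_fst, hp.snd_fst, mul_one, mul_zero, zero_sub, neg_eq_zero] at this
  have h3 : ∀ c e : K, ∀ a, (c • d₁ + e • d₂) y = 0 → (c • d₁ + e • d₂) a = 0 := fun c e a hy =>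
    Derivation.eq_zero_on_adjoin (s := {x, y}) _ (by
      rintro a (rfl | rfl)
      · simp [e1, e2]
      · exact hy) (h.top ▸ mem_top)
  have h4 := fun a => h3 (d₂ y) (-d₁ y) a (by simp; ring)
  have e3 : d₂ y = 0 := by simpa [hp.fst_fst, hp.snd_fst] using h4 u
  have h5 := h3 0 1 v (by simp [e3])
  simp [hp.snd_snd] at h5

open WithZero in
/-- A discrete valuation on `K`, trivial on constants, whose valuation ring is stable under the
derivations `d₁` and `d₂`. -/
structure GoodVal (d₁ d₂ : Derivation ℂ K K) (w : Valuation K (WithZero (Multiplicative ℤ))) :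
    Prop where
  const : ∀ c : ℂ, c ≠ 0 → w (algebraMap ℂ K c) = 1
  unif : ∃ t, w t = exp (-1 : ℤ)
  fst_le : ∀ f, w f ≤ 1 → w (d₁ f) ≤ 1
  snd_le : ∀ f, w f ≤ 1 → w (d₂ f) ≤ 1

section chart

open Polynomial IsDedekindDomain

variable {u v : K} {d₁ d₂ : Derivation ℂ K K}

theorem Derivation.aeval_mem_range (d : Derivation ℂ K K) (hu : d u = 0 ∨ d u = 1)
    (hv : d v = 0 ∨ d v = 1) (p : ℂ⟮u⟯[X]) : ∃ q : ℂ⟮u⟯[X], d (aeval v p) = aeval v q := by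
  have hF : ∀ a ∈ ℂ⟮u⟯, d a ∈ ℂ⟮u⟯ := by
    intro a ha
    induction ha using adjoin_induction with
    | mem x hx =>
      rw [Set.mem_singleton_iff] at hx; subst hx
      rcases hu with h | h <;> rw [h]
      exacts [zero_mem _, one_mem _]
    | algebraMap c => simp
    | add x y _ _ hx hy => rw [map_add]; exact add_mem hx hy
    | inv x hx' hx =>
      rw [Derivation.leibniz_inv, smul_eq_mul]
      exact mul_mem (neg_mem (pow_mem (inv_mem hx') _)) hx
    | mul x y hx' hy' hx hy =>
      rw [Derivation.leibniz, smul_eq_mul, smul_eq_mul]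
      exact add_mem (mul_mem hx' hy) (mul_mem hy' hx)
  have hv' : ∃ q : ℂ⟮u⟯[X], d v = aeval v q := by
    rcases hv with h | h
    exacts [⟨0, by simp [h]⟩, ⟨1, by simp [h]⟩]
  obtain ⟨q₀, hq₀⟩ := hv'
  induction p using Polynomial.induction_on' with
  | add p q hp hq =>
    obtain ⟨a, ha⟩ := hp
    obtain ⟨b, hb⟩ := hq
    exact ⟨a + b, by simp [ha, hb]⟩
  | monomial n a =>
    refine ⟨C a * (C (n : ℂ⟮u⟯) * (X ^ (n - 1) * q₀)) + X ^ n * C ⟨d a, hF a a.2⟩, ?_⟩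
    simp only [aeval_monomial, Derivation.leibniz, Derivation.leibniz_pow, hq₀, map_add, map_mul,
      aeval_C, map_pow, aeval_X, smul_eq_mul, nsmul_eq_mul]
    rfl

theorem exists_aeval_of_goodVal (h : IsCoord u v) (hp : IsPartials u v d₁ d₂) {G : K}
    (hG : ∀ w, GoodVal d₁ d₂ w → w u = 1 → w G ≤ 1) : ∃ p : ℂ⟮u⟯[X], G = aeval v p := by
  let _ : Algebra ℂ⟮u⟯[X] K := (aeval v).toAlgebra
  have hmap : ∀ p : ℂ⟮u⟯[X], algebraMap ℂ⟮u⟯[X] K p = aeval v p := fun _ => rfl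
  have hinj : Function.Injective (algebraMap ℂ⟮u⟯[X] K) :=
    transcendental_iff_injective.mp h.transcendental_right
  have : FaithfulSMul ℂ⟮u⟯[X] K := (faithfulSMul_iff_algebraMap_injective _ _).mpr hinj
  have : IsFractionRing ℂ⟮u⟯[X] K := by
    refine IsFractionRing.of_field _ _ fun z => ?_
    have hz : z ∈ ℂ⟮u⟯⟮v⟯ := h.adjoin_right ▸ mem_top
    obtain ⟨r, s, rfl⟩ := (mem_adjoin_simple_iff _ _).mp hz
    exact ⟨r, s, rfl⟩
  suffices hgood : ∀ P : HeightOneSpectrum ℂ⟮u⟯[X],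
      GoodVal d₁ d₂ (P.valuation K) ∧ P.valuation K u = 1 by
    obtain ⟨p, hp⟩ := HeightOneSpectrum.mem_integers_of_valuation_le_one (R := ℂ⟮u⟯[X]) K G
      (fun P => hG _ (hgood P).1 (hgood P).2)
    exact ⟨p, hp.symm⟩
  intro P
  have hd : ∀ d : Derivation ℂ K K, (∀ p : ℂ⟮u⟯[X], ∃ q : ℂ⟮u⟯[X], d (aeval v p) = aeval v q) →
      ∀ f, P.valuation K f ≤ 1 → P.valuation K (d f) ≤ 1 := by
    intro d hd f hf
    obtain ⟨a, b, hb, hab, rfl⟩ : ∃ a b : ℂ⟮u⟯[X], b ≠ 0 ∧ IsCoprime a b ∧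
        f = algebraMap _ K a / algebraMap _ K b := by
      refine ⟨IsFractionRing.num ℂ⟮u⟯[X] f, IsFractionRing.den ℂ⟮u⟯[X] f,
        nonZeroDivisors.ne_zero (IsFractionRing.den ℂ⟮u⟯[X] f).2,
        (IsFractionRing.num_den_reduced ℂ⟮u⟯[X] f).isCoprime, ?_⟩
      exact (IsFractionRing.mk'_num_den' ..).symm
    rw [P.valuation_div_le_one_iff K a hb] at hf
    · have hb1 : P.valuation K (algebraMap _ K b) = 1 := P.valuation_eq_one_iff_notMem.mpr hf
      obtain ⟨a', ha'⟩ := hd a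
      obtain ⟨b', hb'⟩ := hd b
      rw [← hmap, ← hmap] at ha' hb'
      rw [Derivation.leibniz_div, ha', hb']
      have : (algebraMap ℂ⟮u⟯[X] K b)⁻¹ ^ 2 • (algebraMap ℂ⟮u⟯[X] K b • algebraMap ℂ⟮u⟯[X] K a' -
          algebraMap ℂ⟮u⟯[X] K a • algebraMap ℂ⟮u⟯[X] K b') =
          (algebraMap ℂ⟮u⟯[X] K b)⁻¹ ^ 2 * algebraMap ℂ⟮u⟯[X] K (b * a' - a * b') := by
        simp
      rw [this, map_mul, map_pow, map_inv₀, hb1, inv_one, one_pow, one_mul]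
      exact P.valuation_le_one _
    · intro hbm ham
      obtain ⟨r, s, hrs⟩ := hab
      exact P.isPrime.ne_top ((Ideal.eq_top_iff_one _).mpr
        (hrs ▸ add_mem (P.asIdeal.mul_mem_left _ ham) (P.asIdeal.mul_mem_left _ hbm)))
  have hF : ∀ c : ℂ⟮u⟯, c ≠ 0 → P.valuation K (c : K) = 1 := fun c hc => by
    have h1 : ∀ c : ℂ⟮u⟯, P.valuation K (c : K) ≤ 1 := fun c => by
      have : (c : K) = algebraMap ℂ⟮u⟯[X] K (C c) := by
        rw [hmap, aeval_C]; rfl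
      rw [this]; exact P.valuation_le_one _
    refine le_antisymm (h1 c) ?_
    have h2 := h1 c⁻¹
    rw [IntermediateField.coe_inv, map_inv₀] at h2
    have h0 : P.valuation K (c : K) ≠ 0 := by simpa using hc
    exact (inv_le_one₀ (zero_lt_iff.mpr h0)).mp h2
  refine ⟨⟨fun c hc => ?_, P.valuation_exists_uniformizer K, hd _ ?_, hd _ ?_⟩, ?_⟩
  · exact hF (algebraMap ℂ ℂ⟮u⟯ c) (by simpa using hc)
  · exact Derivation.aeval_mem_range _ (.inr hp.fst_fst) (.inl hp.fst_snd)
  · exact Derivation.aeval_mem_range _ (.inl hp.snd_fst) (.inr hp.snd_snd)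
  · exact hF ⟨u, mem_adjoin_simple_self ℂ u⟩ fun h0 => h.ne_zero_left (congrArg Subtype.val h0)

end chart

end

section

variable {K : Type} [Field K] [Algebra ℂ K]
open IntermediateField

open Polynomial in
theorem not_forall_goodVal {u v : K} {d₁ d₂ : Derivation ℂ K K} (h : IsCoord u v)
    (hp : IsPartials u v d₁ d₂) {J A : K} (hJ : J ≠ 0) (hA : A ≠ 0) {M N : ℕ} (hM : 1 ≤ M)
    (h₁ : ∀ w, GoodVal d₁ d₂ w → w u = 1 → w J ^ M ≤ w A ^ N)
    (h₂ : ∀ w, GoodVal d₁ (-(v ^ 2) • d₂) w → w u = 1 → w (-(v ^ 2) * J) ^ M ≤ w A ^ N) :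
    False := by
  have hv := h.ne_zero_right
  have hdiv : ∀ (w : Valuation K (WithZero (Multiplicative ℤ))) (B : K),
      w B ^ M ≤ w A ^ N → w (B ^ M / A ^ N) ≤ 1 := fun w B hB => by
    rw [map_div₀, map_pow, map_pow]
    exact div_le_one_of_le₀ hB zero_le
  obtain ⟨p, hp1⟩ := exists_aeval_of_goodVal h hp (fun w hw hu => hdiv w J (h₁ w hw hu))
  obtain ⟨q, hq⟩ := exists_aeval_of_goodVal h.inv (hp.inv hv) (fun w hw hu => hdiv w _ (h₂ w hw hu))
  have hp0 : p ≠ 0 := by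
    rintro rfl
    rw [map_zero, div_eq_zero_iff] at hp1
    rcases hp1 with h | h
    exacts [hJ (eq_zero_of_pow_eq_zero h), hA (eq_zero_of_pow_eq_zero h)]
  let _ : Invertible v⁻¹ := invertibleOfNonzero (inv_ne_zero hv)
  have hrev := eval₂_reverse_mul_pow (algebraMap ℂ⟮u⟯ K) v⁻¹ q
  rw [invOf_eq_inv, inv_inv] at hrev
  change aeval v q.reverse * _ = aeval v⁻¹ q at hrev
  rw [← hq, mul_pow, mul_div_assoc, hp1] at hrev
  have key : aeval v (q.reverse) = aeval v (C ((-1) ^ M) * X ^ (2 * M + q.natDegree) * p) := by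
    rw [map_mul, map_mul, aeval_X_pow, aeval_C, pow_add, pow_mul]
    have : (v⁻¹) ^ q.natDegree * v ^ q.natDegree = 1 := by
      rw [← mul_pow, inv_mul_cancel₀ hv, one_pow]
    calc aeval v q.reverse = aeval v q.reverse * (v⁻¹) ^ q.natDegree * v ^ q.natDegree := by
          rw [mul_assoc, this, mul_one]
      _ = _ := by
          rw [hrev, neg_pow, map_pow, map_neg, map_one]; ring
  have key' := transcendental_iff_injective.mp h.transcendental_right key
  have hdeg := congrArg natDegree key'
  rw [natDegree_mul (by simp) hp0, natDegree_C_mul_X_pow _ _ (by simp)] at hdeg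
  have := q.reverse_natDegree_le
  omega

namespace GoodVal

open WithZero

variable {d₁ d₂ : Derivation ℂ K K} {w : Valuation K (WithZero (Multiplicative ℤ))}

theorem const_le (hw : GoodVal d₁ d₂ w) (c : ℂ) : w (algebraMap ℂ K c) ≤ 1 := by
  by_cases hc : c = 0
  · simp [hc]
  · exact (hw.const c hc).le

theorem jacobian_le (hw : GoodVal d₁ d₂ w) {f g : K} (hf : w f ≤ 1) (hg : w g ≤ 1) :
    w (jacobian d₁ d₂ f g) ≤ 1 := by
  rw [jacobian_apply]
  refine w.map_sub_le ?_ ?_ <;> rw [map_mul]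
  exacts [mul_le_one' (hw.fst_le f hf) (hw.snd_le g hg),
    mul_le_one' (hw.snd_le f hf) (hw.fst_le g hg)]

theorem le_exp_neg_one {a : WithZero (Multiplicative ℤ)} (ha : a < 1) : a ≤ exp (-1 : ℤ) := by
  by_cases h0 : a = 0
  · simp [h0]
  · rw [← exp_log h0] at ha ⊢
    rw [← exp_zero, exp_lt_exp] at ha
    rw [exp_le_exp]
    omega

theorem jacobian_le_of_lt (hw : GoodVal d₁ d₂ w) {y : K} (hy : w y < 1) (f : K) :
    w (jacobian d₁ d₂ y f) ≤ w f := by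
  by_cases hf0 : f = 0
  · simp [hf0]
  obtain ⟨t, ht⟩ := hw.unif
  have ht0 : t ≠ 0 := by rintro rfl; exact exp_ne_zero (ht.symm.trans w.map_zero)
  have ht1 : w t ≤ 1 := by rw [ht, ← exp_zero, exp_le_exp]; omega
  have hwf : w f ≠ 0 := by simpa using hf0
  obtain ⟨n, hn⟩ : ∃ n : ℤ, w f = exp n := ⟨log (w f), (exp_log hwf).symm⟩
  have hDt : w (jacobian d₁ d₂ y t) ≤ w t := by
    have hh : w (y / t) ≤ 1 := by
      rw [map_div₀, ht]
      exact div_le_one_of_le₀ (le_exp_neg_one hy) zero_le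
    have : jacobian d₁ d₂ y t = - (t * jacobian d₁ d₂ t (y / t)) := by
      rw [jacobian_swap]
      conv_lhs => rw [← mul_div_cancel₀ y ht0]
      rw [Derivation.leibniz, jacobian_self, smul_zero, add_zero, smul_eq_mul]
    rw [this, Valuation.map_neg, map_mul]
    exact mul_le_of_le_one_right' (hw.jacobian_le ht1 hh)
  have hg : w (f * t ^ n) = 1 := by
    rw [map_mul, map_zpow₀, ht, hn, ← exp_zsmul, ← exp_add, exp_eq_one]
    simp
  have hf : f = (f * t ^ n) * t ^ (-n) := by
    rw [mul_assoc, ← zpow_add₀ ht0]; simp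
  have hwt : w (t ^ (-n)) = w f := by
    conv_rhs => rw [hf, map_mul, hg, one_mul]
  conv_lhs => rw [hf]
  rw [Derivation.leibniz, Derivation.leibniz_zpow]
  refine w.map_add_le ?_ ?_
  · rw [smul_eq_mul, map_mul, hg, one_mul, zsmul_eq_mul, smul_eq_mul, map_mul, map_mul]
    have h1 : w ((-n : ℤ) : K) ≤ 1 := by
      have := hw.const_le ((-n : ℤ) : ℂ)
      rwa [map_intCast] at this
    calc w ((-n : ℤ) : K) * (w (t ^ (-n - 1)) * w (jacobian d₁ d₂ y t))
        ≤ 1 * (w (t ^ (-n - 1)) * w t) := by gcongr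
      _ = w f := by rw [one_mul, ← map_mul, ← zpow_add_one₀ ht0, sub_add_cancel, hwt]
  · rw [smul_eq_mul, map_mul, hwt]
    exact mul_le_of_le_one_right' (hw.jacobian_le hy.le hg.le)

open Polynomial

theorem aevalAeval_le (hw : GoodVal d₁ d₂ w) {x y : K} (hx : w x ≤ 1) (hy : w y ≤ 1)
    (a : ℂ[X][X]) : w (aevalAeval x y a) ≤ 1 := by
  induction a using Polynomial.induction_on' with
  | add p q hp hq => rw [map_add]; exact w.map_add_le hp hq
  | monomial n p =>
    rw [← C_mul_X_pow_eq_monomial, map_mul, map_pow, aevalAeval_C, aevalAeval_Y, map_mul, map_pow]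
    refine mul_le_one' ?_ (pow_le_one' hy _)
    induction p using Polynomial.induction_on' with
    | add p q hp hq => rw [map_add]; exact w.map_add_le hp hq
    | monomial n c =>
      rw [aeval_monomial, map_mul, map_pow]
      exact mul_le_one' (hw.const_le c) (pow_le_one' hx _)

theorem one_le_aevalAeval (hw : GoodVal d₁ d₂ w) {x y : K} (hx : w x < 1) (hy : w y < 1)
    (a : ℂ[X][X]) (ha : (a.coeff 0).coeff 0 ≠ 0) : 1 ≤ w (aevalAeval x y a) := by
  have h : aevalAeval x y a = (x * aevalAeval x y (C (a.coeff 0).divX) +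
      y * aevalAeval x y a.divX) + algebraMap ℂ K ((a.coeff 0).coeff 0) := by
    conv_lhs => rw [← a.divX_mul_X_add, ← (a.coeff 0).divX_mul_X_add]
    simp only [map_add, map_mul, aevalAeval_C, aevalAeval_Y, aeval_X, aeval_C]
    ring
  rw [h, w.map_add_eq_of_lt_right, hw.const _ ha]
  rw [hw.const _ ha]
  refine w.map_add_lt ?_ ?_ <;> rw [map_mul]
  · exact mul_lt_one_of_lt_of_le hx (hw.aevalAeval_le hx.le hy.le _)
  · exact mul_lt_one_of_lt_of_le hy (hw.aevalAeval_le hx.le hy.le _)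

theorem jacobian_aevalAeval {x y : K} (a : ℂ[X][X]) :
    jacobian d₁ d₂ x (aevalAeval x y a) =
      aevalAeval x y (derivative a) * jacobian d₁ d₂ x y := by
  induction a using Polynomial.induction_on' with
  | add p q hp hq => simp only [map_add, hp, hq, add_mul]
  | monomial n p =>
    have h0 : jacobian d₁ d₂ x (aeval x p) = 0 := by
      rw [Derivation.map_aeval, jacobian_self, smul_zero]
    have h1 : ∀ (k : ℕ) (q : ℂ[X]), aevalAeval x y (monomial k q) = aeval x q * y ^ k :=
      fun k q => by
        rw [← C_mul_X_pow_eq_monomial, map_mul, map_pow, aevalAeval_C, aevalAeval_Y]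
    rw [derivative_monomial, h1, h1, Derivation.leibniz, Derivation.leibniz_pow, h0, smul_zero,
      add_zero, map_mul, map_natCast]
    simp only [smul_eq_mul, nsmul_eq_mul]
    ring

theorem pow_jacobian_le_aux (hw : GoodVal d₁ d₂ w) {x y : K} (hx : w x < 1) (i e : ℕ)
    (base : ∀ a : ℂ[X][X], (a.coeff 0).coeff i ≠ 0 →
      w (jacobian d₁ d₂ x y) ^ e ≤ w (aevalAeval x y a)) (j : ℕ) (a : ℂ[X][X])
    (ha : (a.coeff j).coeff i ≠ 0) :
    w (jacobian d₁ d₂ x y) ^ (e + j) ≤ w (aevalAeval x y a) := by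
  induction j generalizing a with
  | zero => exact base a ha
  | succ j ih =>
    have h := ih (derivative a) (by
      rw [coeff_derivative, ← Nat.cast_succ, ← C_eq_natCast, coeff_mul_C]
      exact mul_ne_zero ha (by exact_mod_cast j.succ_ne_zero))
    calc _ = w (jacobian d₁ d₂ x y) ^ (e + j) * w (jacobian d₁ d₂ x y) := pow_succ _ _
      _ ≤ w (aevalAeval x y (derivative a)) * w (jacobian d₁ d₂ x y) := by gcongr
      _ = w (jacobian d₁ d₂ x (aevalAeval x y a)) := by rw [← map_mul, ← jacobian_aevalAeval]
      _ ≤ _ := hw.jacobian_le_of_lt hx _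

theorem coeff_coeff_swap (a : ℂ[X][X]) (i j : ℕ) :
    ((Bivariate.swap a).coeff i).coeff j = (a.coeff j).coeff i := by
  induction a using Polynomial.induction_on' with
  | add p q hp hq => simp only [map_add, coeff_add, hp, hq]
  | monomial n p =>
    induction p using Polynomial.induction_on' with
    | add p q hp hq => simp only [map_add, coeff_add, hp, hq]
    | monomial m c =>
      rw [Bivariate.swap_monomial_monomial]
      simp only [coeff_monomial]
      split_ifs <;> simp_all [coeff_monomial]

theorem pow_jacobian_le (hw : GoodVal d₁ d₂ w) {x y : K} (hx : w x < 1) (hy : w y < 1)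
    (i j : ℕ) (a : ℂ[X][X]) (ha : (a.coeff j).coeff i ≠ 0) :
    w (jacobian d₁ d₂ x y) ^ (i + j) ≤ w (aevalAeval x y a) := by
  refine hw.pow_jacobian_le_aux hx i i (fun b hb => ?_) j a ha
  have h := hw.pow_jacobian_le_aux (y := x) hy 0 0
    (fun c hc => by simpa using hw.one_le_aevalAeval hy hx c hc) i (Bivariate.swap b)
    (by rwa [coeff_coeff_swap])
  rwa [zero_add, Bivariate.aevalAeval_swap, jacobian_swap, Valuation.map_neg] at h

end GoodVal

end

section

variable {K : Type} [Field K] [Algebra ℂ K]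
open IntermediateField

namespace MoveClosed

variable {P : K → K → Prop} {x y : K}

theorem inv_left (hP : MoveClosed P) (h : P x y) : P x⁻¹ y := hP.swap (hP.inv (hP.swap h))

theorem add_const (hP : MoveClosed P) (h : P x y) (c : ℂ) : P x (y + algebraMap ℂ K c) :=
  hP.add h (IntermediateField.algebraMap_mem _ c)

theorem add_const_left (hP : MoveClosed P) (h : P x y) (c : ℂ) : P (x + algebraMap ℂ K c) y :=
  hP.swap (hP.add_const (hP.swap h) c)

theorem mul_zpow (hP : MoveClosed P) (h : P x y) (k : ℤ) : P x (y * x ^ k) := by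
  rw [mul_comm]
  exact hP.mul h (zpow_mem (mem_adjoin_simple_self ℂ x) k)
    (zpow_ne_zero k (hP.coord h).ne_zero_left)

end MoveClosed

/-- The span of the monomials in `x` and `y` with exponents in `S`. -/
def monomialSpan (x y : K) (S : Set (ℕ × ℕ)) : Submodule ℂ K :=
  Submodule.span ℂ ((fun p : ℕ × ℕ => x ^ p.1 * y ^ p.2) '' S)

section monomialSpan

variable {x y x' y' A : K} {S S' : Set (ℕ × ℕ)}

theorem monomial_mem_monomialSpan {i j : ℕ} (h : (i, j) ∈ S) :
    x ^ i * y ^ j ∈ monomialSpan x y S :=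
  Submodule.subset_span ⟨(i, j), h, rfl⟩

theorem mul_mem_monomialSpan {c : K} (hA : A ∈ monomialSpan x y S)
    (h : ∀ i j, (i, j) ∈ S → x ^ i * y ^ j * c ∈ monomialSpan x' y' S') :
    A * c ∈ monomialSpan x' y' S' := by
  induction hA using Submodule.span_induction with
  | mem a ha =>
    obtain ⟨⟨i, j⟩, hij, rfl⟩ := ha
    exact h i j hij
  | zero => simp
  | add a b _ _ ha hb => rw [add_mul]; exact add_mem ha hb
  | smul r a _ ha => rw [smul_mul_assoc]; exact Submodule.smul_mem _ _ ha

theorem monomialSpan_le_add_const_left (hS : ∀ i i' j, i' ≤ i → (i, j) ∈ S → (i', j) ∈ S) (p : ℂ) :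
    monomialSpan x y S ≤ monomialSpan (x + algebraMap ℂ K p) y S := by
  intro A hA
  rw [← mul_one A]
  refine mul_mem_monomialSpan hA fun i j hij => ?_
  have : x ^ i = ((x + algebraMap ℂ K p) + algebraMap ℂ K (-p)) ^ i := by simp
  rw [mul_one, this, add_pow, Finset.sum_mul]
  refine Submodule.sum_mem _ fun k hk => ?_
  have hm := monomial_mem_monomialSpan (x := x + algebraMap ℂ K p) (y := y)
    (hS i k j (Nat.lt_succ_iff.mp (Finset.mem_range.mp hk)) hij)
  convert Submodule.smul_mem _ ((-p) ^ (i - k) * (i.choose k : ℂ)) hm using 1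
  rw [Algebra.smul_def, map_mul, map_pow, map_natCast]
  ring

theorem monomialSpan_le_add_const_right (hS : ∀ i j j', j' ≤ j → (i, j) ∈ S → (i, j') ∈ S) (p : ℂ) :
    monomialSpan x y S ≤ monomialSpan x (y + algebraMap ℂ K p) S := by
  intro A hA
  rw [← mul_one A]
  refine mul_mem_monomialSpan hA fun i j hij => ?_
  have : y ^ j = ((y + algebraMap ℂ K p) + algebraMap ℂ K (-p)) ^ j := by simp
  rw [mul_one, this, add_pow, Finset.mul_sum]
  refine Submodule.sum_mem _ fun k hk => ?_
  have hm := monomial_mem_monomialSpan (x := x) (y := y + algebraMap ℂ K p)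
    (hS i j k (Nat.lt_succ_iff.mp (Finset.mem_range.mp hk)) hij)
  convert Submodule.smul_mem _ ((-p) ^ (j - k) * (j.choose k : ℂ)) hm using 1
  rw [Algebra.smul_def, map_mul, map_pow, map_natCast]
  ring

open Polynomial in
theorem mem_monomialSpan_iff : A ∈ monomialSpan x y S ↔ ∃ a : ℂ[X][X],
    (∀ i j, (a.coeff j).coeff i ≠ 0 → (i, j) ∈ S) ∧ aevalAeval x y a = A := by
  have hmon : ∀ (i j : ℕ) (c : ℂ), aevalAeval x y (monomial j (monomial i c)) =
      c • (x ^ i * y ^ j) := fun i j c => by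
    rw [← C_mul_X_pow_eq_monomial, map_mul, map_pow, aevalAeval_C, aevalAeval_Y, aeval_monomial,
      Algebra.smul_def, mul_assoc]
  constructor
  · intro hA
    induction hA using Submodule.span_induction with
    | mem a ha =>
      obtain ⟨⟨i, j⟩, hij, rfl⟩ := ha
      refine ⟨monomial j (monomial i 1), fun i' j' h => ?_, by rw [hmon, one_smul]⟩
      rw [coeff_monomial] at h
      split_ifs at h with h1
      · rw [coeff_monomial] at h
        split_ifs at h with h2
        · exact h1 ▸ h2 ▸ hij
        · exact absurd rfl h
      · simp at h
    | zero => exact ⟨0, by simp, by simp⟩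
    | add a b _ _ ha hb =>
      obtain ⟨p, hp, rfl⟩ := ha
      obtain ⟨q, hq, rfl⟩ := hb
      refine ⟨p + q, fun i j h => ?_, by simp⟩
      by_contra hS
      refine h ?_
      rw [coeff_add, coeff_add, not_not.mp (mt (hp i j) hS), not_not.mp (mt (hq i j) hS), add_zero]
    | smul r a _ ha =>
      obtain ⟨p, hp, rfl⟩ := ha
      refine ⟨r • p, fun i j h => hp i j fun h0 => h ?_, by simp⟩
      rw [coeff_smul, coeff_smul, h0, smul_zero]
  · rintro ⟨a, ha, rfl⟩
    rw [a.as_sum_support, map_sum]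
    refine Submodule.sum_mem _ fun j _ => ?_
    rw [(a.coeff j).as_sum_support, map_sum, map_sum]
    refine Submodule.sum_mem _ fun i hi => ?_
    rw [hmon]
    exact Submodule.smul_mem _ _ (monomial_mem_monomialSpan (ha i j (mem_support_iff.mp hi)))

end monomialSpan

/-- The exponents of the monomials of degree at most `e` in `y` and of weighted degree at most
`D`, where `x` has weight `1` and `y` has weight `n`. -/
def region (e : ℕ) (n D : ℤ) : Set (ℕ × ℕ) :=
  {p | p.2 ≤ e ∧ p.1 + n * p.2 ≤ D}

/-- The exponents of the monomials of multiplicity at least `m` at the origin. -/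
def multGe (m : ℕ) : Set (ℕ × ℕ) := {p | m ≤ p.1 + p.2}

/-- A representation of `u` as a fraction `A / B` of polynomials in an admissible coordinate
system, with Newton polygons in `S`. -/
structure FracRep (P : K → K → Prop) (u : K) (S : Set (ℕ × ℕ)) (x y A B : K) : Prop where
  adm : P x y
  num_mem : A ∈ monomialSpan x y S
  den_mem : B ∈ monomialSpan x y S
  den_ne : B ≠ 0
  eq : A = u * B

namespace FracRep

variable {P : K → K → Prop} {u x y x' y' A B : K} {S S' : Set (ℕ × ℕ)}

theorem mono (h : FracRep P u S x y A B) (hS : S ⊆ S') : FracRep P u S' x y A B :=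
  have hle : monomialSpan x y S ≤ monomialSpan x y S' :=
    Submodule.span_mono (Set.image_mono hS)
  ⟨h.adm, hle h.num_mem, hle h.den_mem, h.den_ne, h.eq⟩

theorem monomialChange (h : FracRep P u S x y A B) (h' : P x' y') {c : K} (hc : c ≠ 0)
    (hS : ∀ i j, (i, j) ∈ S → ∃ i' j', (i', j') ∈ S' ∧ x ^ i * y ^ j * c = x' ^ i' * y' ^ j') :
    FracRep P u S' x' y' (A * c) (B * c) := by
  have hS' : ∀ i j, (i, j) ∈ S → x ^ i * y ^ j * c ∈ monomialSpan x' y' S' := fun i j hij => by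
    obtain ⟨i', j', hij', heq⟩ := hS i j hij
    exact heq ▸ monomial_mem_monomialSpan hij'
  exact ⟨h', mul_mem_monomialSpan h.num_mem hS', mul_mem_monomialSpan h.den_mem hS',
    mul_ne_zero h.den_ne hc, by rw [h.eq, mul_assoc]⟩

variable {e : ℕ} {n D : ℤ}

theorem flip_right (hP : MoveClosed P) (h : FracRep P u (region e n D) x y A B) :
    FracRep P u (region e (-n) (D - n * e)) x y⁻¹ (A * y ^ (-(e : ℤ))) (B * y ^ (-(e : ℤ))) := by
  have hy := (hP.coord h.adm).ne_zero_right
  refine h.monomialChange (hP.inv h.adm) (zpow_ne_zero _ hy) ?_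
  rintro i j ⟨h1, h2⟩
  dsimp only at h1 h2
  refine ⟨i, e - j, ⟨by simp, ?_⟩, ?_⟩
  · push_cast [h1]
    linarith
  · rw [mul_assoc, ← zpow_natCast y j, ← zpow_natCast y⁻¹, inv_zpow', ← zpow_add₀ hy]
    push_cast [h1]
    congr 2; ring

theorem flip_left (hP : MoveClosed P) (h : FracRep P u (region e n D) x y A B) :
    FracRep P u (region e n D) x⁻¹ (y * x ^ (-n)) (A * x ^ (-D)) (B * x ^ (-D)) := by
  have hx := (hP.coord h.adm).ne_zero_left
  refine h.monomialChange (hP.inv_left (hP.mul_zpow h.adm _)) (zpow_ne_zero _ hx) ?_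
  rintro i j ⟨h1, h2⟩
  dsimp only at h1 h2
  obtain ⟨k, hk⟩ := Int.eq_ofNat_of_zero_le (sub_nonneg.mpr h2)
  refine ⟨k, j, ⟨h1, ?_⟩, ?_⟩
  · dsimp only; rw [← hk]; linarith [Int.natCast_nonneg i]
  · rw [← zpow_natCast x i, ← zpow_natCast x⁻¹ k, ← hk, inv_zpow', mul_pow,
      ← zpow_natCast (x ^ (-n)), ← zpow_mul,
      mul_right_comm, ← zpow_add₀ hx, mul_left_comm, ← zpow_add₀ hx, mul_comm]
    congr 2; ring

theorem blowUp (hP : MoveClosed P) {m : ℕ} (h : FracRep P u (region e n D ∩ multGe m) x y A B) :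
    FracRep P u (region e (n - 1) (D - m)) x (y * x ^ (-1 : ℤ)) (A * x ^ (-(m : ℤ)))
      (B * x ^ (-(m : ℤ))) := by
  have hx := (hP.coord h.adm).ne_zero_left
  refine h.monomialChange (hP.mul_zpow h.adm _) (zpow_ne_zero _ hx) ?_
  rintro i j ⟨⟨h1, h2⟩, h3⟩
  simp only [multGe, Set.mem_ofPred_eq] at h1 h2 h3
  refine ⟨i + j - m, j, ⟨h1, ?_⟩, ?_⟩
  · push_cast [h3]; linarith
  · rw [mul_pow, ← zpow_natCast x i, ← zpow_natCast x (i + j - m), ← zpow_natCast (x ^ (-1 : ℤ)),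
      ← zpow_mul, mul_right_comm, ← zpow_add₀ hx, mul_left_comm, ← zpow_add₀ hx, mul_comm]
    push_cast [h3]
    congr 2; ring

theorem swap (hP : MoveClosed P) (hD : 0 ≤ D) (h : FracRep P u (region e 0 D) x y A B) :
    FracRep P u (region D.toNat 0 e) y x A B := by
  have := h.monomialChange (S' := region D.toNat 0 e) (hP.swap h.adm) one_ne_zero ?_
  · simpa using this
  rintro i j ⟨h1, h2⟩
  simp only [zero_mul, add_zero] at h1 h2
  exact ⟨j, i, ⟨by dsimp only; omega, by simpa using h1⟩, by ring⟩

theorem div_right (h0 : y ≠ 0)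
    (h : FracRep P u (region (e + 1) n D ∩ {p | 1 ≤ p.2}) x y A B) :
    FracRep P u (region e n (D - n)) x y (A * y⁻¹) (B * y⁻¹) := by
  refine h.monomialChange h.adm (inv_ne_zero h0) ?_
  rintro i j ⟨⟨h1, h2⟩, h4⟩
  simp only [Set.mem_ofPred_eq] at h1 h2 h4
  obtain ⟨k, rfl⟩ := Nat.exists_eq_add_of_le' h4
  refine ⟨i, k, ⟨by dsimp only; omega, ?_⟩, ?_⟩
  · push_cast at h2 ⊢; linarith
  · rw [pow_succ]; field_simp

theorem div_left (h0 : x ≠ 0) (h : FracRep P u (region e n D ∩ {p | 1 ≤ p.1}) x y A B) :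
    FracRep P u (region e n (D - 1)) x y (A * x⁻¹) (B * x⁻¹) := by
  refine h.monomialChange h.adm (inv_ne_zero h0) ?_
  rintro i j ⟨⟨h1, h2⟩, h4⟩
  simp only [Set.mem_ofPred_eq] at h1 h2 h4
  obtain ⟨k, rfl⟩ := Nat.exists_eq_add_of_le' h4
  refine ⟨k, j, ⟨h1, ?_⟩, ?_⟩
  · push_cast at h2 ⊢; linarith
  · rw [pow_succ]; field_simp

theorem add_const_left (hP : MoveClosed P) (h : FracRep P u (region e n D) x y A B) (p : ℂ) :
    FracRep P u (region e n D) (x + algebraMap ℂ K p) y A B := by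
  have hle := monomialSpan_le_add_const_left (x := x) (y := y) (S := region e n D) (by
    rintro i i' j hi ⟨h1, h2⟩
    dsimp only at h1 h2
    have : (i' : ℤ) ≤ i := by exact_mod_cast hi
    exact ⟨h1, by dsimp only; linarith⟩) p
  exact ⟨hP.add_const_left h.adm p, hle h.num_mem, hle h.den_mem, h.den_ne, h.eq⟩

theorem add_const_right (hP : MoveClosed P) (hn : 0 ≤ n) (h : FracRep P u (region e n D) x y A B)
    (p : ℂ) : FracRep P u (region e n D) x (y + algebraMap ℂ K p) A B := by
  have hle := monomialSpan_le_add_const_right (x := x) (y := y) (S := region e n D) (by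
    rintro i j j' hj ⟨h1, h2⟩
    dsimp only at h1 h2
    have : n * (j' : ℤ) ≤ n * j := mul_le_mul_of_nonneg_left (by exact_mod_cast hj) hn
    exact ⟨hj.trans h1, by dsimp only; linarith⟩) p
  exact ⟨hP.add_const h.adm p, hle h.num_mem, hle h.den_mem, h.den_ne, h.eq⟩

end FracRep

end

section

variable {K : Type} [Field K] [Algebra ℂ K]
open IntermediateField

section denominators

open Polynomial

variable {x y : K} {e : ℕ}

theorem mul_aeval_mem_monomialSpan {D : ℕ} {A : K} (hA : A ∈ monomialSpan x y (region e 0 D))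
    (f : ℂ[X]) : A * aeval x f ∈ monomialSpan x y (region e 0 (D + f.natDegree : ℕ)) := by
  refine mul_mem_monomialSpan hA fun i j hij => ?_
  obtain ⟨h1, h2⟩ := hij
  rw [aeval_eq_sum_range, Finset.mul_sum]
  refine Submodule.sum_mem _ fun k hk => ?_
  rw [mul_smul_comm]
  refine Submodule.smul_mem _ _ ?_
  have : x ^ i * y ^ j * x ^ k = x ^ (i + k) * y ^ j := by ring
  rw [this]
  refine monomial_mem_monomialSpan ⟨h1, ?_⟩
  have := Finset.mem_range.mp hk
  simp only [zero_mul, add_zero] at h2 ⊢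
  push_cast
  omega

theorem exists_mul_aeval_mem_monomialSpan (α : ℂ⟮x⟯[X]) (hα : α.natDegree ≤ e) :
    ∃ d : ℂ[X], aeval x d ≠ 0 ∧
      ∃ D : ℕ, aeval y α * aeval x d ∈ monomialSpan x y (region e 0 D) := by
  refine Polynomial.induction_with_natDegree_le (fun α : ℂ⟮x⟯[X] => ∃ d : ℂ[X], aeval x d ≠ 0 ∧
      ∃ D : ℕ, aeval y α * aeval x d ∈ monomialSpan x y (region e 0 D)) e
    ⟨1, by simp, 0, by simp⟩ ?_ ?_ α hα
  · intro n a _ hn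
    obtain ⟨r, s, hrs⟩ := (mem_adjoin_simple_iff ℂ (a : K)).mp a.2
    have hy : y ^ n ∈ monomialSpan x y (region e 0 (0 : ℕ)) := by
      have : y ^ n = x ^ 0 * y ^ n := by simp
      rw [this]
      exact monomial_mem_monomialSpan ⟨hn, by simp⟩
    have hval : aeval y (C a * X ^ n) = (a : K) * y ^ n := by
      rw [map_mul, aeval_X_pow, aeval_C]; rfl
    by_cases hs : aeval x s = 0
    · refine ⟨1, by simp, 0, ?_⟩
      rw [hval, hrs, hs, div_zero, zero_mul, zero_mul]
      exact zero_mem _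
    · refine ⟨s, hs, 0 + r.natDegree, ?_⟩
      rw [hval, hrs, mul_right_comm, div_mul_cancel₀ _ hs, mul_comm]
      exact mul_aeval_mem_monomialSpan hy r
  · rintro p q - - ⟨d₁, hd₁, D₁, h₁⟩ ⟨d₂, hd₂, D₂, h₂⟩
    refine ⟨d₁ * d₂, by rw [map_mul]; exact mul_ne_zero hd₁ hd₂,
      (D₁ + d₂.natDegree) + (D₂ + d₁.natDegree), ?_⟩
    have hmono : ∀ {a b : ℕ}, a ≤ b → monomialSpan x y (region e 0 a) ≤
        monomialSpan x y (region e 0 b) := fun hab =>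
      Submodule.span_mono (Set.image_mono fun p hp =>
        ⟨hp.1, hp.2.trans (by exact_mod_cast hab)⟩)
    have : aeval y (p + q) * aeval x (d₁ * d₂) =
        aeval y p * aeval x d₁ * aeval x d₂ + aeval y q * aeval x d₂ * aeval x d₁ := by
      rw [map_add, map_mul]; ring
    rw [this]
    exact add_mem (hmono (Nat.le_add_right _ _) (mul_aeval_mem_monomialSpan h₁ d₂))
      (hmono (Nat.le_add_left _ _) (mul_aeval_mem_monomialSpan h₂ d₁))

theorem exists_fracRep {P : K → K → Prop} {u : K} (h : P x y) (α β : ℂ⟮x⟯[X])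
    (hα : α.natDegree ≤ e) (hβ : β.natDegree ≤ e) (hne : aeval y β ≠ 0)
    (heq : aeval y α = u * aeval y β) :
    ∃ D A B, FracRep P u (region e 0 D) x y A B := by
  obtain ⟨d₁, hd₁, D₁, h₁⟩ := exists_mul_aeval_mem_monomialSpan (y := y) α hα
  obtain ⟨d₂, hd₂, D₂, h₂⟩ := exists_mul_aeval_mem_monomialSpan (y := y) β hβ
  have hmono : ∀ {a b : ℕ}, a ≤ b → monomialSpan x y (region e 0 a) ≤
      monomialSpan x y (region e 0 b) := fun hab =>
    Submodule.span_mono (Set.image_mono fun p hp =>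
      ⟨hp.1, hp.2.trans (by exact_mod_cast hab)⟩)
  refine ⟨((D₁ + d₂.natDegree) + (D₂ + d₁.natDegree) : ℕ), aeval y α * aeval x d₁ * aeval x d₂,
    aeval y β * aeval x d₂ * aeval x d₁, h,
    hmono (Nat.le_add_right _ _) (mul_aeval_mem_monomialSpan h₁ d₂),
    hmono (Nat.le_add_left _ _) (mul_aeval_mem_monomialSpan h₂ d₁),
    mul_ne_zero (mul_ne_zero hne hd₂) hd₁, ?_⟩
  rw [heq]; ring

end denominators

/-- The region `region e n D` is minimal among those which represent `u`. -/
structure MinimalRegion (P : K → K → Prop) (u : K) (e : ℕ) (n D : ℤ) : Prop where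
  degree_le : ∀ {e' n' D' x y A B}, FracRep P u (region e' n' D') x y A B → e ≤ e'
  le : ∀ {n' D' x y A B}, FracRep P u (region e n' D') x y A B → 2 * D - e * n ≤ 2 * D' - e * n'

namespace GoodVal

open Polynomial

variable {d₁ d₂ : Derivation ℂ K K} {w : Valuation K (WithZero (Multiplicative ℤ))}

theorem aeval_eq_one (hw : GoodVal d₁ d₂ w) {x : K}
    (hx : ∀ p : ℂ, w (x + algebraMap ℂ K p) = 1) (f : ℂ[X]) (hf : f ≠ 0) : w (aeval x f) = 1 := by
  have hs : f.Splits := IsAlgClosed.splits f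
  induction hs using Submonoid.closure_induction with
  | mem g hg =>
    rcases hg with ⟨c, rfl⟩ | ⟨c, rfl⟩
    · rw [aeval_C]; exact hw.const c (by rintro rfl; simp at hf)
    · simpa using hx c
  | one => simp
  | mul a b _ _ ha hb =>
    rw [map_mul, map_mul, ha (left_ne_zero_of_mul hf), hb (right_ne_zero_of_mul hf), one_mul]

theorem eq_one_of_mem_adjoin (hw : GoodVal d₁ d₂ w) {x : K}
    (hx : ∀ p : ℂ, w (x + algebraMap ℂ K p) = 1) {a : K} (ha : a ∈ ℂ⟮x⟯) (ha0 : a ≠ 0) :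
    w a = 1 := by
  obtain ⟨r, s, rfl⟩ := (mem_adjoin_simple_iff ℂ a).mp ha
  have hr : r ≠ 0 := by rintro rfl; simp at ha0
  have hs : s ≠ 0 := by rintro rfl; simp at ha0
  rw [map_div₀, hw.aeval_eq_one hx r hr, hw.aeval_eq_one hx s hs, div_one]

theorem aeval_adjoin_le (hw : GoodVal d₁ d₂ w) {x y : K}
    (hx : ∀ p : ℂ, w (x + algebraMap ℂ K p) = 1) (hy : w y ≤ 1) (f : ℂ⟮x⟯[X]) :
    w (aeval y f) ≤ 1 := by
  rw [aeval_eq_sum_range]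
  refine w.map_sum_le fun i _ => ?_
  rw [Algebra.smul_def, map_mul, map_pow]
  refine mul_le_one' ?_ (pow_le_one' hy _)
  change w ((f.coeff i : ℂ⟮x⟯) : K) ≤ 1
  by_cases h : ((f.coeff i : ℂ⟮x⟯) : K) = 0
  · simp [h]
  · exact (hw.eq_one_of_mem_adjoin hx (f.coeff i).2 h).le

end GoodVal

namespace MinimalRegion

variable {P : K → K → Prop} {u x y A B : K} {e : ℕ} {n D : ℤ}
  {d₁ d₂ : Derivation ℂ K K} {w : Valuation K (WithZero (Multiplicative ℤ))}

open Polynomial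

theorem exists_adjoin_poly (hA : A ∈ monomialSpan x y (region e n D)) :
    ∃ α : ℂ⟮x⟯[X], α.natDegree ≤ e ∧ aeval y α = A := by
  obtain ⟨a, ha, rfl⟩ := mem_monomialSpan_iff.mp hA
  have hx : x ∈ ℂ⟮x⟯ := mem_adjoin_simple_self ℂ x
  refine ⟨a.map (aeval (⟨x, hx⟩ : ℂ⟮x⟯)).toRingHom, ?_, ?_⟩
  · refine natDegree_map_le.trans (natDegree_le_iff_coeff_eq_zero.mpr fun j hj => ?_)
    ext i
    by_contra h
    exact absurd (ha i j (by simpa using h)).1 (not_le.mpr hj)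
  · clear ha hA
    induction a using Polynomial.induction_on' with
    | add p q hp hq => simp only [Polynomial.map_add, map_add, hp, hq]
    | monomial k f =>
      rw [map_monomial, ← C_mul_X_pow_eq_monomial, ← C_mul_X_pow_eq_monomial, map_mul, map_mul,
        aeval_X_pow, map_pow, aevalAeval_C, aevalAeval_Y, aeval_C]
      congr 1
      change algebraMap ℂ⟮x⟯ K (aeval _ f) = _
      rw [← aeval_algebraMap_apply]
      rfl

theorem exists_center_left (hmin : MinimalRegion P u e n D) (he : 1 ≤ e)
    (hw : GoodVal d₁ d₂ w) (hu : w u = 1) (h : FracRep P u (region e n D) x y A B)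
    (hx : w x ≤ 1) (hy : w y ≤ 1) (hA : w A < 1) : ∃ p : ℂ, w (x + algebraMap ℂ K p) < 1 := by
  by_contra! hcon
  have hx1 : ∀ p : ℂ, w (x + algebraMap ℂ K p) = 1 := fun p =>
    le_antisymm (w.map_add_le hx (hw.const_le p)) (hcon p)
  obtain ⟨α, hα, hαA⟩ := exists_adjoin_poly h.num_mem
  obtain ⟨β, hβ, hβB⟩ := exists_adjoin_poly h.den_mem
  let I : Ideal ℂ⟮x⟯[X] :=
    { carrier := {f | w (aeval y f) < 1}
      add_mem' := fun {a b} ha hb => by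
        rw [Set.mem_ofPred_eq, map_add]; exact w.map_add_lt ha hb
      zero_mem' := by simp
      smul_mem' := fun c f hf => by
        rw [Set.mem_ofPred_eq, smul_eq_mul, map_mul, map_mul, mul_comm]
        exact mul_lt_one_of_lt_of_le hf (hw.aeval_adjoin_le hx1 hy c) }
  have hmem : ∀ f, f ∈ I ↔ w (aeval y f) < 1 := fun f => Iff.rfl
  obtain ⟨π, hπ⟩ := (IsPrincipalIdealRing.principal I).principal
  have hπI : w (aeval y π) < 1 := by
    rw [← hmem, hπ]; exact Submodule.mem_span_singleton_self π
  have hB : w B < 1 := by rwa [h.eq, map_mul, hu, one_mul] at hA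
  have hdvd : ∀ f : ℂ⟮x⟯[X], w (aeval y f) < 1 → π ∣ f := fun f hf => by
    rw [← hmem, hπ] at hf
    exact Ideal.mem_span_singleton.mp hf
  obtain ⟨α', rfl⟩ := hdvd α (by rwa [hαA])
  obtain ⟨β', rfl⟩ := hdvd β (by rwa [hβB])
  have hβ0 : aeval y (π * β') ≠ 0 := hβB ▸ h.den_ne
  rw [map_mul] at hαA hβB hβ0
  have hπ0 : π ≠ 0 := by rintro rfl; simp at hβ0
  have hdeg : 1 ≤ π.natDegree := by
    by_contra! h0
    obtain ⟨c, rfl⟩ := natDegree_eq_zero.mp (Nat.lt_one_iff.mp h0)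
    rw [aeval_C] at hπI
    refine hπI.ne (hw.eq_one_of_mem_adjoin hx1 c.2 ?_)
    intro hc
    exact hπ0 (by rw [Subtype.ext (a1 := c) (a2 := 0) hc, C_0])
  have hle : ∀ f : ℂ⟮x⟯[X], (π * f).natDegree ≤ e → f.natDegree ≤ e - 1 := fun f hf => by
    by_cases hf0 : f = 0
    · simp [hf0]
    · rw [natDegree_mul hπ0 hf0] at hf; omega
  obtain ⟨D', A', B', h'⟩ := exists_fracRep (u := u) h.adm α' β' (hle _ hα) (hle _ hβ)
    (right_ne_zero_of_mul hβ0) (by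
      have := h.eq
      rw [← hαA, ← hβB, mul_left_comm] at this
      exact mul_left_cancel₀ (left_ne_zero_of_mul hβ0) this)
  have := hmin.degree_le h'
  omega

theorem exists_center_right (hmin : MinimalRegion P u e n D) (hP : MoveClosed P)
    (hw : GoodVal d₁ d₂ w) (hu : w u = 1) (h : FracRep P u (region e n D) x y A B)
    (hx : w x < 1) (hy : w y ≤ 1) (hA : w A < 1) : ∃ q : ℂ, w (y + algebraMap ℂ K q) < 1 := by
  by_contra! hcon
  have hy1 : ∀ p : ℂ, w (y + algebraMap ℂ K p) = 1 := fun p =>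
    le_antisymm (w.map_add_le hy (hw.const_le p)) (hcon p)
  have hB : w B < 1 := by rwa [h.eq, map_mul, hu, one_mul] at hA
  have key : ∀ C, C ∈ monomialSpan x y (region e n D) → w C < 1 →
      C ∈ monomialSpan x y (region e n D ∩ {p | 1 ≤ p.1}) := by
    intro A hA hlt
    obtain ⟨a, ha, rfl⟩ := mem_monomialSpan_iff.mp hA
    refine mem_monomialSpan_iff.mpr ⟨a, fun i j hij => ⟨ha i j hij, ?_⟩, rfl⟩
    rcases Nat.eq_zero_or_pos i with rfl | hi
    · exfalso
      set b := Bivariate.swap a with hb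
      have hb0 : b.coeff 0 ≠ 0 := fun h0 => hij (by rw [← GoodVal.coeff_coeff_swap, ← hb, h0,
        coeff_zero])
      have hval : aevalAeval x y a = x * aevalAeval y x b.divX + aeval y (b.coeff 0) := by
        rw [← Bivariate.aevalAeval_swap, ← hb]
        conv_lhs => rw [← b.divX_mul_X_add]
        rw [map_add, map_mul, aevalAeval_C, aevalAeval_Y, mul_comm]
      have h1 := hw.aeval_eq_one hy1 _ hb0
      have h2 : w (x * aevalAeval y x b.divX) < 1 := by
        rw [map_mul]
        exact mul_lt_one_of_lt_of_le hx (hw.aevalAeval_le hy hx.le _)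
      rw [hval, w.map_add_eq_of_lt_right (h1 ▸ h2), h1] at hlt
      exact lt_irrefl _ hlt
    · exact hi
  have h' : FracRep P u (region e n D ∩ {p | 1 ≤ p.1}) x y A B :=
    ⟨h.adm, key A h.num_mem hA, key B h.den_mem hB, h.den_ne, h.eq⟩
  have := hmin.le (h'.div_left (hP.coord h.adm).ne_zero_left)
  omega

theorem pow_jacobian_le_of_center (hw : GoodVal d₁ d₂ w) (hu : w u = 1)
    {M N : ℕ} (H : ∀ {m}, FracRep P u (region e n D ∩ multGe m) x y A B → N * m ≤ M)
    (h : FracRep P u (region e n D) x y A B) (hx : w x < 1) (hy : w y < 1) :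
    w (jacobian d₁ d₂ x y) ^ M ≤ w A ^ N := by
  obtain ⟨a, ha, haA⟩ := mem_monomialSpan_iff.mp h.num_mem
  obtain ⟨b, hb, hbB⟩ := mem_monomialSpan_iff.mp h.den_mem
  have hex : ∃ m i j, i + j = m ∧ ((a.coeff j).coeff i ≠ 0 ∨ (b.coeff j).coeff i ≠ 0) := by
    by_contra! hcon
    refine h.den_ne ?_
    rw [← hbB]
    have : b = 0 := by
      ext j i
      exact (hcon _ i j rfl).2
    rw [this, map_zero]
  classical
  obtain ⟨i, j, hij, hor⟩ := Nat.find_spec hex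
  have hmin : ∀ i j, ((a.coeff j).coeff i ≠ 0 ∨ (b.coeff j).coeff i ≠ 0) →
      Nat.find hex ≤ i + j := fun i j h => Nat.find_min' hex ⟨i, j, rfl, h⟩
  have hNm := H (m := Nat.find hex) ⟨h.adm,
    mem_monomialSpan_iff.mpr ⟨a, fun i j hc => ⟨ha i j hc, hmin i j (.inl hc)⟩, haA⟩,
    mem_monomialSpan_iff.mpr ⟨b, fun i j hc => ⟨hb i j hc, hmin i j (.inr hc)⟩, hbB⟩,
    h.den_ne, h.eq⟩
  have hJ : w (jacobian d₁ d₂ x y) ≤ 1 := hw.jacobian_le hx.le hy.le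
  have hle : w (jacobian d₁ d₂ x y) ^ (i + j) ≤ w A := by
    rcases hor with h1 | h1
    · rw [← haA]; exact hw.pow_jacobian_le hx hy i j a h1
    · rw [h.eq, map_mul, hu, one_mul, ← hbB]; exact hw.pow_jacobian_le hx hy i j b h1
  rw [hij] at hle
  calc _ ≤ w (jacobian d₁ d₂ x y) ^ (Nat.find hex * N) :=
        pow_le_pow_right_of_le_one' hJ (by rwa [mul_comm])
    _ = (w (jacobian d₁ d₂ x y) ^ Nat.find hex) ^ N := pow_mul _ _ _
    _ ≤ _ := pow_le_pow_left' hle N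

theorem jacobian_add_const (p q : ℂ) :
    jacobian d₁ d₂ (x + algebraMap ℂ K p) (y + algebraMap ℂ K q) = jacobian d₁ d₂ x y := by
  simp [jacobian_apply]

theorem pow_jacobian_le_of_integral (hmin : MinimalRegion P u e n D) (he : 1 ≤ e)
    (hP : MoveClosed P) (hw : GoodVal d₁ d₂ w) (hu : w u = 1) {M N : ℕ}
    (H : ∀ {m x y A B}, FracRep P u (region e n D ∩ multGe m) x y A B → N * m ≤ M)
    (h : FracRep P u (region e n D) x y A B) (hx : w x ≤ 1) (hy : w y ≤ 1)
    (hn : 0 ≤ n ∨ w y < 1) :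
    w (jacobian d₁ d₂ x y) ^ M ≤ w A ^ N := by
  have hA : w A ≤ 1 := by
    obtain ⟨a, -, rfl⟩ := mem_monomialSpan_iff.mp h.num_mem
    exact hw.aevalAeval_le hx hy a
  rcases hA.eq_or_lt with hA | hA
  · rw [hA, one_pow]
    exact pow_le_one' (hw.jacobian_le hx hy) _
  obtain ⟨p, hp⟩ := hmin.exists_center_left he hw hu h hx hy hA
  have h1 := h.add_const_left hP p
  obtain ⟨q, hq, h2⟩ : ∃ q : ℂ, w (y + algebraMap ℂ K q) < 1 ∧
      FracRep P u (region e n D) (x + algebraMap ℂ K p) (y + algebraMap ℂ K q) A B := by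
    rcases hn with hn | hn
    · obtain ⟨q, hq⟩ := hmin.exists_center_right hP hw hu h1 hp hy hA
      exact ⟨q, hq, h1.add_const_right hP hn q⟩
    · exact ⟨0, by simpa using hn, by simpa using h1⟩
  rw [← jacobian_add_const p q]
  exact pow_jacobian_le_of_center hw hu H h2 hp hq

end MinimalRegion

end

section

variable {K : Type} [Field K] [Algebra ℂ K]
open IntermediateField

theorem Valuation.pow_le_pow_of_rescale {L : Type} [Field L]
    {w : Valuation L (WithZero (Multiplicative ℤ))} {s J A : L} (hs : 1 < w s) {p q : ℤ} {M N : ℕ}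
    (hpq : p * M ≤ q * N)
    (h : w (J * s ^ (-p)) ^ M ≤ w (A * s ^ (-q)) ^ N) : w J ^ M ≤ w A ^ N := by
  have h0 : w s ≠ 0 := (zero_lt_one.trans hs).ne'
  rw [map_mul, map_mul, map_zpow₀, map_zpow₀, mul_pow, mul_pow, ← zpow_natCast (w s ^ _),
    ← zpow_natCast (w s ^ _), ← zpow_mul, ← zpow_mul] at h
  calc w J ^ M = w J ^ M * w s ^ (-p * M) * w s ^ (p * M) := by
        rw [mul_assoc, ← zpow_add₀ h0]; simp
    _ ≤ w A ^ N * w s ^ (-q * N) * w s ^ (q * N) := by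
        gcongr
        exact hs.le
    _ = w A ^ N := by rw [mul_assoc, ← zpow_add₀ h0]; simp

section jacobian

variable {d₁ d₂ : Derivation ℂ K K} {x y : K}

theorem jacobian_inv_right :
    jacobian d₁ d₂ x y⁻¹ = - (jacobian d₁ d₂ x y * y ^ (-2 : ℤ)) := by
  rw [Derivation.leibniz_inv, smul_eq_mul, neg_mul, mul_comm, inv_pow, zpow_neg]
  norm_cast

theorem jacobian_inv_left_mul_zpow (hx : x ≠ 0) (n : ℤ) :
    jacobian d₁ d₂ x⁻¹ (y * x ^ n) = - (jacobian d₁ d₂ x y * x ^ (-(2 - n))) := by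
  have h1 : jacobian d₁ d₂ x (y * x ^ n) = jacobian d₁ d₂ x y * x ^ n := by
    rw [Derivation.leibniz, Derivation.leibniz_zpow, jacobian_self]
    simp [mul_comm]
  rw [jacobian_swap, jacobian_inv_right, jacobian_swap d₁ d₂ _ x, h1, neg_mul, neg_neg, mul_assoc,
    ← zpow_add₀ hx]
  congr 3; ring

end jacobian

namespace FracRep

variable {P : K → K → Prop} {u x y A B : K} {e : ℕ} {n D : ℤ}

theorem mul_le (h : FracRep P u (region e n D) x y A B) (he : 1 ≤ e)
    (hdeg : ∀ {e' n' D' x y A B}, FracRep P u (region e' n' D') x y A B → e ≤ e') :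
    n * e ≤ D := by
  by_contra! hlt
  have h' : FracRep P u (region (e - 1) n D) x y A B := h.mono (by
    rintro ⟨i, j⟩ ⟨h1, h2⟩
    refine ⟨?_, h2⟩
    dsimp only at h1 h2 ⊢
    rcases h1.eq_or_lt with rfl | h1
    · omega
    · omega)
  have := hdeg h'
  omega

theorem nonneg (h : FracRep P u (region e n D) x y A B) (he : 1 ≤ e) (hP : MoveClosed P)
    (hdeg : ∀ {e' n' D' x y A B}, FracRep P u (region e' n' D') x y A B → e ≤ e') : 0 ≤ D := by
  have := (h.flip_right hP).mul_le he hdeg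
  linarith

theorem nonneg_of_region_zero (h : FracRep P u (region 0 n D) x y A B) : 0 ≤ D := by
  by_contra! hD
  have hempty : region 0 n D = ∅ := by
    refine Set.eq_empty_of_forall_notMem ?_
    rintro ⟨i, j⟩ ⟨h1, h2⟩
    obtain rfl : j = 0 := Nat.le_zero.mp h1
    dsimp only at h2
    push_cast at h2
    linarith [Int.natCast_nonneg i]
  have hB := h.den_mem
  rw [hempty, monomialSpan, Set.image_empty, Submodule.span_empty, Submodule.mem_bot] at hB
  exact h.den_ne hB

end FracRep

namespace MinimalRegion

variable {P : K → K → Prop} {u x y A B : K} {e : ℕ} {n D : ℤ}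
  {d₁ d₂ : Derivation ℂ K K} {w : Valuation K (WithZero (Multiplicative ℤ))}

theorem flip (hmin : MinimalRegion P u e n D) : MinimalRegion P u e (-n) (D - n * e) :=
  ⟨hmin.degree_le, fun h => by have := hmin.le h; linarith⟩

theorem pow_jacobian_le (hmin : MinimalRegion P u e n D) (he : 1 ≤ e) (hP : MoveClosed P)
    (hw : GoodVal d₁ d₂ w) (hu : w u = 1) {M N : ℕ} (hn : 0 ≤ n)
    (H₁ : ∀ {m x y A B}, FracRep P u (region e n D ∩ multGe m) x y A B → N * m ≤ M)
    (H₂ : ∀ {m x y A B}, FracRep P u (region e (-n) (D - n * e) ∩ multGe m) x y A B → N * m ≤ M)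
    (hMe : 2 * M ≤ e * N) (hMD : (n + 2) * M ≤ D * N)
    (h : FracRep P u (region e n D) x y A B) :
    w (jacobian d₁ d₂ x y) ^ M ≤ w A ^ N := by
  have key : ∀ {x y A B}, w x ≤ 1 → FracRep P u (region e n D) x y A B →
      w (jacobian d₁ d₂ x y) ^ M ≤ w A ^ N := by
    intro x y A B hx h
    rcases le_or_gt (w y) 1 with hy | hy
    · exact hmin.pow_jacobian_le_of_integral he hP hw hu H₁ h hx hy (.inl hn)
    · have hy' : w y⁻¹ < 1 := by rw [map_inv₀]; exact inv_lt_one_of_one_lt₀ hy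
      have := hmin.flip.pow_jacobian_le_of_integral he hP hw hu H₂ (h.flip_right hP) hx hy'.le
        (.inr hy')
      rw [jacobian_inv_right, Valuation.map_neg] at this
      exact Valuation.pow_le_pow_of_rescale hy (p := 2) (by exact_mod_cast hMe) this
  rcases le_or_gt (w x) 1 with hx | hx
  · exact key hx h
  · have hx' : w x⁻¹ ≤ 1 := by rw [map_inv₀]; exact (inv_lt_one_of_one_lt₀ hx).le
    have := key hx' (h.flip_left hP)
    rw [jacobian_inv_left_mul_zpow (hP.coord h.adm).ne_zero_left, Valuation.map_neg] at this
    exact Valuation.pow_le_pow_of_rescale hx (by linarith) this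

theorem two_mul_le (hmin : MinimalRegion P u e n D) (hP : MoveClosed P) {m : ℕ}
    (h : FracRep P u (region e n D ∩ multGe m) x y A B) : 2 * m ≤ e := by
  have := hmin.le (h.blowUp hP)
  have : (2 * m : ℤ) ≤ e := by linarith
  exact_mod_cast this

/-- The Noether–Fano inequality. -/
theorem noether_fano {v : K} (hmin : MinimalRegion P u e n D) (he : 1 ≤ e) (hP : MoveClosed P)
    (huv : IsCoord u v) (hd : IsPartials u v d₁ d₂) {M N : ℕ} (hM : 1 ≤ M) (hn : 0 ≤ n)
    (H₁ : ∀ {m x y A B}, FracRep P u (region e n D ∩ multGe m) x y A B → N * m ≤ M)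
    (H₂ : ∀ {m x y A B}, FracRep P u (region e (-n) (D - n * e) ∩ multGe m) x y A B → N * m ≤ M)
    (hMe : 2 * M ≤ e * N) (h : FracRep P u (region e n D) x y A B) : D * N < (n + 2) * M := by
  by_contra! hMD
  refine not_forall_goodVal huv hd (J := jacobian d₁ d₂ x y) (A := A) (M := M) (N := N)
    ((hP.coord h.adm).jacobian_ne_zero hd) ?_ hM ?_ ?_
  · rw [h.eq]; exact mul_ne_zero huv.ne_zero_left h.den_ne
  · exact fun w hw hu => hmin.pow_jacobian_le he hP hw hu hn H₁ H₂ hMe hMD h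
  · intro w hw hu
    rw [← jacobian_smul_right]
    exact hmin.pow_jacobian_le he hP hw hu hn H₁ H₂ hMe hMD h

theorem degree_eq_zero_of_nonneg {v : K} (hmin : MinimalRegion P u e n D) (hP : MoveClosed P)
    (huv : IsCoord u v) (hd : IsPartials u v d₁ d₂) (hn : 0 ≤ n)
    (h : FracRep P u (region e n D) x y A B) : e = 0 := by
  by_contra he0
  have he : 1 ≤ e := Nat.one_le_iff_ne_zero.mpr he0
  have hnD := h.mul_le he hmin.degree_le
  have hD := h.nonneg he hP hmin.degree_le
  have h2 := hmin.noether_fano he hP huv hd (M := e) (N := 2) he hn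
    (hmin.two_mul_le hP) (hmin.flip.two_mul_le hP) (by omega) h
  have hn2 : n < 2 := by
    by_contra! h2n
    have : (2 : ℤ) * e ≤ n * e := mul_le_mul_of_nonneg_right h2n (by positivity)
    push_cast at h2
    nlinarith
  have swap_le : ∀ {D x y A B}, 0 ≤ D → FracRep P u (region e 0 D) x y A B → (e : ℤ) ≤ D :=
    fun hD h => by have := hmin.degree_le (h.swap hP hD); omega
  obtain rfl | rfl : n = 0 ∨ n = 1 := by omega
  · have := swap_le hD h
    push_cast at h2
    linarith
  · push_cast at h2
    have hM : (D.toNat : ℤ) = D := Int.toNat_of_nonneg hD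
    have hNF := hmin.noether_fano he hP huv hd (M := D.toNat) (N := 3) (by omega) hn
      (fun {m x y A B} hm => by
        have h1 := hm.blowUp hP
        rw [sub_self] at h1
        have h3 := hmin.le h1
        have h4 := swap_le (by omega) h1
        omega)
      (fun {m x y A B} hm => by
        by_contra! hlt
        obtain ⟨k, rfl⟩ := Nat.exists_eq_add_of_le' he
        have h1 : FracRep P u (region (k + 1) (-1) (D - 1 * ↑(k + 1)) ∩ {p | 1 ≤ p.2}) x y A B :=
          hm.mono (by
            rintro ⟨i, j⟩ ⟨⟨h1, h2⟩, h3⟩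
            refine ⟨⟨h1, h2⟩, ?_⟩
            simp only [multGe, Set.mem_ofPred_eq] at h1 h2 h3 ⊢
            omega)
        have := hmin.degree_le (h1.div_right (hP.coord hm.adm).ne_zero_right)
        omega)
      (by omega) h
    rw [hM] at hNF
    push_cast at hNF
    linarith

theorem degree_eq_zero {v : K} (hmin : MinimalRegion P u e n D) (hP : MoveClosed P)
    (huv : IsCoord u v) (hd : IsPartials u v d₁ d₂)
    (h : FracRep P u (region e n D) x y A B) : e = 0 := by
  rcases le_total 0 n with hn | hn
  · exact hmin.degree_eq_zero_of_nonneg hP huv hd hn h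
  · exact hmin.flip.degree_eq_zero_of_nonneg hP huv hd (by omega) (h.flip_right hP)

end MinimalRegion

theorem exists_minimalRegion {P : K → K → Prop} {u x y : K} (hP : MoveClosed P) (h : P x y) :
    ∃ e n D x y A B, MinimalRegion P u e n D ∧ FracRep P u (region e n D) x y A B := by
  have hex : ∃ e : ℕ, ∃ n D x y A B, FracRep P u (region e n D) x y A B := by
    obtain ⟨α, β, hαβ⟩ := (mem_adjoin_simple_iff ℂ⟮x⟯ u).mp
      (show u ∈ ℂ⟮x⟯⟮y⟯ from (hP.coord h).adjoin_right ▸ mem_top)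
    by_cases hβ : Polynomial.aeval y β = 0
    · obtain ⟨D, A, B, hr⟩ := exists_fracRep (u := u) (e := 0) h 0 1 (by simp) (by simp) (by simp)
        (by rw [hαβ, hβ]; simp)
      exact ⟨0, 0, D, x, y, A, B, hr⟩
    · obtain ⟨D, A, B, hr⟩ := exists_fracRep (u := u) h α β (le_max_left _ _) (le_max_right _ _) hβ
        (by rw [hαβ, div_mul_cancel₀ _ hβ])
      exact ⟨_, 0, D, x, y, A, B, hr⟩
  classical
  obtain ⟨n₀, D₀, x₀, y₀, A₀, B₀, h₀⟩ := Nat.find_spec hex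
  have hdeg : ∀ {e' n' D' x y A B}, FracRep P u (region e' n' D') x y A B → Nat.find hex ≤ e' :=
    fun h => Nat.find_min' hex ⟨_, _, _, _, _, _, h⟩
  generalize Nat.find hex = e at h₀ hdeg
  have hbound : ∀ {n D x y A B}, FracRep P u (region e n D) x y A B → 0 ≤ 2 * D - e * n := by
    intro n D x y A B h
    rcases Nat.eq_zero_or_pos e with rfl | he
    · simpa using h.nonneg_of_region_zero
    · have h1 := h.mul_le he hdeg
      have h2 := h.nonneg he hP hdeg
      linarith
  have hex' : ∃ c : ℕ, ∃ n D x y A B, FracRep P u (region e n D) x y A B ∧ 2 * D - e * n = c := by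
    obtain ⟨c, hc⟩ := Int.eq_ofNat_of_zero_le (hbound h₀)
    exact ⟨c, n₀, D₀, x₀, y₀, A₀, B₀, h₀, hc⟩
  obtain ⟨c, ⟨n, D, x, y, A, B, hr, hc⟩, hmin⟩ :
      ∃ c : ℕ, (∃ n D x y A B, FracRep P u (region e n D) x y A B ∧ 2 * D - e * n = c) ∧
        ∀ c' : ℕ, (∃ n D x y A B, FracRep P u (region e n D) x y A B ∧ 2 * D - e * n = c') →
          c ≤ c' :=
    ⟨Nat.find hex', Nat.find_spec hex', fun _ => Nat.find_min' hex'⟩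
  refine ⟨e, n, D, x, y, A, B, ⟨hdeg, fun {n' D' x' y' A' B'} h' => ?_⟩, hr⟩
  obtain ⟨c', hc'⟩ := Int.eq_ofNat_of_zero_le (hbound h')
  have := hmin c' ⟨n', D', x', y', A', B', h', hc'⟩
  rw [hc, hc']
  exact_mod_cast this

theorem FracRep.mem_adjoin {P : K → K → Prop} {u x y A B : K} {n D : ℤ}
    (h : FracRep P u (region 0 n D) x y A B) : u ∈ ℂ⟮x⟯ := by
  have key : ∀ C ∈ monomialSpan x y (region 0 n D), C ∈ ℂ⟮x⟯ := by
    intro C hC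
    induction hC using Submodule.span_induction with
    | mem a ha =>
      obtain ⟨⟨i, j⟩, hij, rfl⟩ := ha
      have : j = 0 := Nat.le_zero.mp hij.1
      subst this
      simpa using pow_mem (mem_adjoin_simple_self ℂ x) i
    | zero => exact zero_mem _
    | add a b _ _ ha hb => exact add_mem ha hb
    | smul r a _ ha => exact IntermediateField.smul_mem _ ha
  have : u = A / B := by rw [h.eq, mul_div_cancel_right₀ _ h.den_ne]
  rw [this]
  exact div_mem (key A h.num_mem) (key B h.den_mem)

/-- A nonempty family of coordinate systems closed under elementary moves contains every
coordinate system. -/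
theorem MoveClosed.total {P : K → K → Prop} (hP : MoveClosed P) {x y u v : K} (h : P x y)
    (huv : IsCoord u v) {d₁ d₂ : Derivation ℂ K K} (hd : IsPartials u v d₁ d₂) : P u v := by
  obtain ⟨e, n, D, x', y', A, B, hmin, hr⟩ := exists_minimalRegion (u := u) hP h
  obtain rfl := hmin.degree_eq_zero hP huv hd hr
  exact hP.of_mem_adjoin hr.adm huv hr.mem_adjoin

end

/-- STATEMENT 8: `Cr(2)` admits no non-trivial finite-dimensional complex representation. -/
theorem Cr2_no_nontrivial_finite_dimensional_representation
    (m : ℕ) (ρ : Cr 2 →* GL (Fin m) ℂ) :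
    ∀ g : Cr 2, ρ g = 1 := by
  intro g
  obtain ⟨d₁, d₂, hd⟩ := exists_isPartials_X
  obtain ⟨-, σ, hσ, hx, hy⟩ := (CoordRel.moveClosed (CoordRel.hasScaling_ker ρ)).total
    ⟨isCoord_X.map g, 1, one_mem _, rfl, rfl⟩ isCoord_X hd
  have h1 : σ * g = 1 := isCoord_X.equiv_ext hx hy
  rw [MonoidHom.mem_ker] at hσ
  simpa [hσ] using congrArg ρ h1

end
end

section
/- For every natural number n ≥ 2 and every natural number m, there is no injective group homomorphism from the Cremona group Cr(n) to GL_m(ℂ); that is, Cr(n) is not linear. -/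
open scoped MatrixGroups

noncomputable section

/-- Birkhoff's lemma: if a commutator of two invertible endomorphisms commutes with both of them
and has prime order `p`, then the dimension of the space is at least `p`. -/
theorem Module.End.prime_le_finrank_of_mul_eq_mul_mul {V : Type*} [AddCommGroup V] [Module ℂ V]
    [FiniteDimensional ℂ V] {p : ℕ} (hp : p.Prime) (a b : (Module.End ℂ V)ˣ)
    (c : Module.End ℂ V) (hab : (a * b : Module.End ℂ V) = c * (b * a))
    (hca : c * a = a * c) (hcb : c * b = b * c) (hcp : c ^ p = 1) (hc : c ≠ 1) :
    p ≤ Module.finrank ℂ V := by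
  have : Nontrivial V := by
    by_contra h
    rw [not_nontrivial_iff_subsingleton] at h
    exact hc (LinearMap.ext fun x => Subsingleton.elim _ _)
  let q : Polynomial ℂ := ∑ i ∈ Finset.range p, Polynomial.X ^ i
  have hq : Polynomial.aeval c q = ∑ i ∈ Finset.range p, c ^ i := by simp [q]
  have hnu : ¬ IsUnit (Polynomial.aeval c q) := fun hu => by
    have h := geom_sum_mul c p
    rw [← hq, hcp, sub_self] at h
    exact hc (sub_eq_zero.mp (hu.mul_right_eq_zero.mp h))
  have h0 : (0 : ℂ) ∈ spectrum ℂ (Polynomial.aeval c q) := spectrum.zero_mem ℂ hnu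
  rw [spectrum.map_polynomial_aeval_of_nonempty c q
    (spectrum.nonempty_of_isAlgClosed_of_finiteDimensional ℂ c)] at h0
  obtain ⟨l, hl, hlq⟩ := h0
  have hlq : ∑ i ∈ Finset.range p, l ^ i = 0 := by
    simpa [q, Polynomial.eval_finsetSum] using hlq
  have hl1 : l ≠ 1 := by
    rintro rfl
    simp [hp.ne_zero] at hlq
  have hlp : l ^ p = 1 := by
    have h := geom_sum_mul l p
    rw [hlq, zero_mul] at h
    exact (sub_eq_zero.mp h.symm)
  have hord : orderOf l = p := (hp.eq_one_or_self_of_dvd _ (orderOf_dvd_of_pow_eq_one hlp)).resolve_left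
    (by rwa [orderOf_eq_one_iff])
  have hev : c.HasEigenvalue l := Module.End.hasEigenvalue_iff_mem_spectrum.mpr hl
  let W := c.eigenspace l
  have hWpos : 0 < Module.finrank ℂ W := by
    rw [Module.finrank_pos_iff, Submodule.nontrivial_iff_ne_bot]
    exact hev
  have hW {f : Module.End ℂ V} (hf : c * f = f * c) : ∀ x ∈ W, f x ∈ W := fun x hx => by
    have h := LinearMap.congr_fun hf x
    simp only [W, Module.End.mem_eigenspace_iff, Module.End.mul_apply] at hx h ⊢
    rw [h, hx, map_smul]
  have hdet (u : (Module.End ℂ V)ˣ) (hu : c * u = u * c) :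
      LinearMap.det ((u : Module.End ℂ V).restrict (hW hu)) ≠ 0 := fun h => by
    have hker := LinearMap.bot_lt_ker_of_det_eq_zero h
    refine hker.ne' (LinearMap.ker_eq_bot'.mpr fun x hx => Subtype.ext ?_)
    have hx' : (u : Module.End ℂ V) x = 0 := congrArg Subtype.val hx
    have h := LinearMap.congr_fun u.inv_mul (x : V)
    rw [Module.End.mul_apply, hx', map_zero] at h
    exact h.symm
  have hrel : (a : Module.End ℂ V).restrict (hW hca) * (b : Module.End ℂ V).restrict (hW hcb) =
      l • ((b : Module.End ℂ V).restrict (hW hcb) * (a : Module.End ℂ V).restrict (hW hca)) := by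
    ext x
    have h := LinearMap.congr_fun hab (x : V)
    have hx := Module.End.mem_eigenspace_iff.mp (hW hcb _ (hW hca _ x.2))
    simp only [Module.End.mul_apply] at h
    simpa [hx] using h
  have h := congrArg LinearMap.det hrel
  rw [LinearMap.det_smul, map_mul, map_mul, mul_comm (LinearMap.det (LinearMap.restrict _ (hW hcb))),
    eq_comm, mul_eq_right₀ (mul_ne_zero (hdet a hca) (hdet b hcb))] at h
  calc p = orderOf l := hord.symm
    _ ≤ Module.finrank ℂ W := Nat.le_of_dvd hWpos (orderOf_dvd_of_pow_eq_one h)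
    _ ≤ Module.finrank ℂ V := Submodule.finrank_le W

/-- For a nonzero polynomial `a` not involving `xᵢ`, there is an element of the Cremona group
mapping `xᵢ` to `a xᵢ` and fixing the other variables. -/
theorem Cr.exists_apply_X_eq_update {n : ℕ} (i : Fin n) (a : MvPolynomial (Fin n) ℂ) (ha : a ≠ 0)
    (hai : ∀ v c, MvPolynomial.eval (Function.update v i c) a = MvPolynomial.eval v a) :
    ∃ f : Cr n, ∀ j, f (algebraMap (MvPolynomial (Fin n) ℂ) _ (MvPolynomial.X j)) =
      algebraMap (MvPolynomial (Fin n) ℂ) _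
        (Function.update MvPolynomial.X i (a * MvPolynomial.X i) j) := by
  let F := FractionRing (MvPolynomial (Fin n) ℂ)
  let φ : MvPolynomial (Fin n) ℂ →ₐ[ℂ] MvPolynomial (Fin n) ℂ :=
    MvPolynomial.aeval (Function.update MvPolynomial.X i (a * MvPolynomial.X i))
  have hφX (j) : φ (MvPolynomial.X j) =
      Function.update MvPolynomial.X i (a * MvPolynomial.X i) j := by simp [φ]
  have heval (v : Fin n → ℂ) (q : MvPolynomial (Fin n) ℂ) : MvPolynomial.eval v (φ q) =
      MvPolynomial.eval (Function.update v i (MvPolynomial.eval v a * v i)) q := by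
    have : (MvPolynomial.aeval v).comp φ = MvPolynomial.aeval (R := ℂ)
        (Function.update v i (MvPolynomial.eval v a * v i)) := by
      ext j
      rw [AlgHom.comp_apply, hφX]
      rcases eq_or_ne j i with rfl | hj
      · simp [MvPolynomial.aeval_eq_eval]
      · simp [hj]
    simpa [MvPolynomial.aeval_eq_eval] using DFunLike.congr_fun this q
  have hφa : φ a = a := MvPolynomial.funext fun v => by rw [heval, hai]
  have hinj : Function.Injective φ := by
    refine (injective_iff_map_eq_zero φ).mpr fun q hq => ?_
    refine (mul_eq_zero.mp (?_ : a * q = 0)).resolve_left ha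
    refine MvPolynomial.funext fun v => ?_
    rw [map_mul, map_zero]
    by_cases hv : MvPolynomial.eval v a = 0
    · rw [hv, zero_mul]
    · have h := heval (Function.update v i (v i / MvPolynomial.eval v a)) q
      rw [hq, map_zero, hai, Function.update_self, Function.update_idem, mul_div_cancel₀ _ hv,
        Function.update_eq_self] at h
      rw [← h, mul_zero]
  have hinj' : Function.Injective ((IsScalarTower.toAlgHom ℂ (MvPolynomial (Fin n) ℂ) F).comp φ) :=
    (IsFractionRing.injective _ F).comp hinj
  let g : F →ₐ[ℂ] F := IsFractionRing.liftAlgHom hinj'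
  have hg (q) : g (algebraMap (MvPolynomial (Fin n) ℂ) F q) = algebraMap (MvPolynomial (Fin n) ℂ) F (φ q) :=
    IsFractionRing.lift_algebraMap hinj' q
  have hpoly (q) : algebraMap (MvPolynomial (Fin n) ℂ) F q ∈ g.fieldRange := by
    induction q using MvPolynomial.induction_on with
    | C r =>
      have : algebraMap (MvPolynomial (Fin n) ℂ) F (MvPolynomial.C r) = algebraMap ℂ F r :=
        (IsScalarTower.algebraMap_apply ℂ (MvPolynomial (Fin n) ℂ) F r).symm
      rw [this]
      exact g.fieldRange.algebraMap_mem r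
    | add p q hp hq => rw [map_add]; exact add_mem hp hq
    | mul_X p j hp =>
      rw [map_mul]
      refine mul_mem hp ?_
      rcases eq_or_ne j i with rfl | hj
      · refine ⟨algebraMap (MvPolynomial (Fin n) ℂ) F (MvPolynomial.X j) / algebraMap (MvPolynomial (Fin n) ℂ) F a, ?_⟩
        have ha' : algebraMap (MvPolynomial (Fin n) ℂ) F a ≠ 0 := by simpa using ha
        change g _ = _
        rw [map_div₀, hg, hg, hφa, hφX, Function.update_self, map_mul, mul_div_cancel_left₀ _ ha']
      · refine ⟨algebraMap (MvPolynomial (Fin n) ℂ) F (MvPolynomial.X j), ?_⟩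
        change g _ = _
        rw [hg, hφX, Function.update_of_ne hj]
  have hsurj : Function.Surjective g := fun x => by
    obtain ⟨p, q, -, rfl⟩ := IsFractionRing.div_surjective (A := MvPolynomial (Fin n) ℂ) x
    exact div_mem (hpoly p) (hpoly q)
  exact ⟨AlgEquiv.ofBijective g ⟨g.toRingHom.injective, hsurj⟩, fun j => by
    rw [← hφX]; exact hg _⟩

theorem Cr.ext_X {n : ℕ} {f g : Cr n}
    (h : ∀ j, f (algebraMap (MvPolynomial (Fin n) ℂ) _ (MvPolynomial.X j)) =
      g (algebraMap (MvPolynomial (Fin n) ℂ) _ (MvPolynomial.X j))) : f = g := by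
  let F := FractionRing (MvPolynomial (Fin n) ℂ)
  have hp : (f : F →ₐ[ℂ] F).comp (IsScalarTower.toAlgHom ℂ (MvPolynomial (Fin n) ℂ) F) =
      (g : F →ₐ[ℂ] F).comp (IsScalarTower.toAlgHom ℂ (MvPolynomial (Fin n) ℂ) F) :=
    MvPolynomial.algHom_ext h
  ext x
  obtain ⟨p, q, -, rfl⟩ := IsFractionRing.div_surjective (A := MvPolynomial (Fin n) ℂ) x
  rw [map_div₀, map_div₀]
  exact congrArg₂ _ (DFunLike.congr_fun hp p) (DFunLike.congr_fun hp q)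

/-- Multiplying `xᵢ` by a constant and multiplying `xⱼ` by `xᵢ` generate a Heisenberg group, whose
centre multiplies `xⱼ` by the constant. -/
theorem AlgEquiv.heisenberg_apply {K L ι : Type*} [CommSemiring K] [CommSemiring L] [Algebra K L]
    {a b c : L ≃ₐ[K] L} {x : ι → L} {i j : ι} {z : K} (hij : i ≠ j)
    (hai : a (x i) = algebraMap K L z * x i) (ha : ∀ k, k ≠ i → a (x k) = x k)
    (hbj : b (x j) = x i * x j) (hb : ∀ k, k ≠ j → b (x k) = x k)
    (hcj : c (x j) = algebraMap K L z * x j) (hc : ∀ k, k ≠ j → c (x k) = x k) (k : ι) :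
    (a * b) (x k) = (c * (b * a)) (x k) ∧ (c * a) (x k) = (a * c) (x k) ∧
      (c * b) (x k) = (b * c) (x k) := by
  have haj := ha j hij.symm
  have hbi := hb i hij
  have hci := hc i hij
  simp only [AlgEquiv.mul_apply]
  rcases eq_or_ne k i with rfl | hki
  · simp only [hai, hbi, hci, map_mul, AlgEquiv.commutes, and_self]
  rcases eq_or_ne k j with rfl | hkj
  · simp only [hai, haj, hbj, hcj, hci, map_mul, AlgEquiv.commutes, mul_left_comm, mul_assoc,
      and_self]
  · simp only [ha k hki, hb k hkj, hc k hkj, and_self]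

/-- The Cremona group of rank at least two contains Heisenberg groups modulo every prime. -/
theorem Cr.exists_commutator_of_prime_order {n : ℕ} (hn : 2 ≤ n) {p : ℕ} (hp : p.Prime) :
    ∃ a b c : Cr n, a * b = c * (b * a) ∧ c * a = a * c ∧ c * b = b * c ∧ c ^ p = 1 ∧ c ≠ 1 := by
  let x : Fin n → FractionRing (MvPolynomial (Fin n) ℂ) := fun k =>
    algebraMap (MvPolynomial (Fin n) ℂ) _ (MvPolynomial.X k)
  obtain ⟨z, hz⟩ : ∃ z : ℂ, IsPrimitiveRoot z p :=
    ⟨_, Complex.isPrimitiveRoot_exp p hp.ne_zero⟩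
  have hz0 : (MvPolynomial.C z : MvPolynomial (Fin n) ℂ) ≠ 0 := by
    simpa using hz.ne_zero hp.ne_zero
  have hconst : algebraMap (MvPolynomial (Fin n) ℂ) (FractionRing (MvPolynomial (Fin n) ℂ))
      (MvPolynomial.C z) = algebraMap ℂ _ z :=
    (IsScalarTower.algebraMap_apply ℂ (MvPolynomial (Fin n) ℂ) _ z).symm
  let i : Fin n := ⟨0, by omega⟩
  let j : Fin n := ⟨1, by omega⟩
  have hij : i ≠ j := by simp [i, j]
  obtain ⟨a, ha⟩ := Cr.exists_apply_X_eq_update i (MvPolynomial.C z) hz0 (by simp)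
  obtain ⟨b, hb⟩ := Cr.exists_apply_X_eq_update j (MvPolynomial.X i) (MvPolynomial.X_ne_zero i)
    (by simp [hij])
  obtain ⟨c, hc⟩ := Cr.exists_apply_X_eq_update j (MvPolynomial.C z) hz0 (by simp)
  have hai : a (x i) = algebraMap ℂ _ z * x i := by
    rw [ha, Function.update_self, map_mul, hconst]
  have hbj : b (x j) = x i * x j := by
    rw [hb, Function.update_self, map_mul]
  have hcj : c (x j) = algebraMap ℂ _ z * x j := by
    rw [hc, Function.update_self, map_mul, hconst]
  have ha' (k) (hk : k ≠ i) : a (x k) = x k := by rw [ha, Function.update_of_ne hk]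
  have hb' (k) (hk : k ≠ j) : b (x k) = x k := by rw [hb, Function.update_of_ne hk]
  have hc' (k) (hk : k ≠ j) : c (x k) = x k := by rw [hc, Function.update_of_ne hk]
  have hrel := AlgEquiv.heisenberg_apply hij hai ha' hbj hb' hcj hc'
  have hpowj (m : ℕ) : (c ^ m) (x j) = algebraMap ℂ _ (z ^ m) * x j := by
    induction m with
    | zero => rw [pow_zero, pow_zero, map_one, one_mul, AlgEquiv.one_apply]
    | succ m ih =>
      rw [pow_succ', AlgEquiv.mul_apply, ih, map_mul, AlgEquiv.commutes, hcj, pow_succ, map_mul,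
        mul_assoc]
  have hpow (m : ℕ) (k) (hk : k ≠ j) : (c ^ m) (x k) = x k := by
    induction m with
    | zero => rw [pow_zero, AlgEquiv.one_apply]
    | succ m ih => rw [pow_succ', AlgEquiv.mul_apply, ih, hc' k hk]
  refine ⟨a, b, c, Cr.ext_X fun k => (hrel k).1, Cr.ext_X fun k => (hrel k).2.1,
    Cr.ext_X fun k => (hrel k).2.2, Cr.ext_X fun k => ?_, fun h => ?_⟩
  · change (c ^ p) (x k) = x k
    rcases eq_or_ne k j with rfl | hk
    · rw [hpowj, hz.pow_eq_one, map_one, one_mul]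
    · exact hpow p k hk
  · have h1 := hc j
    rw [h, AlgEquiv.one_apply, Function.update_self] at h1
    have h2 := IsFractionRing.injective (MvPolynomial (Fin n) ℂ)
      (FractionRing (MvPolynomial (Fin n) ℂ)) h1
    rw [eq_comm, mul_eq_right₀ (MvPolynomial.X_ne_zero j), ← map_one MvPolynomial.C] at h2
    exact hz.ne_one hp.one_lt (MvPolynomial.C_injective _ _ h2)

/-- STATEMENT 10: for `n ≥ 2`, the Cremona group `Cr(n)` is not linear: there is no
injective group homomorphism `Cr(n) → GL_m(ℂ)`. -/
theorem Crn_not_linear (n m : ℕ) (hn : 2 ≤ n) (ρ : Cr n →* GL (Fin m) ℂ) :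
    ¬ Function.Injective ρ := by
  intro hρ
  obtain ⟨p, hmp, hp⟩ := Nat.exists_infinite_primes (m + 1)
  obtain ⟨a, b, c, hab, hca, hcb, hcp, hc⟩ := Cr.exists_commutator_of_prime_order hn hp
  let σ : Cr n →* (Module.End ℂ (Fin m → ℂ))ˣ :=
    (Matrix.GeneralLinearGroup.toLin : GL (Fin m) ℂ ≃* _).toMonoidHom.comp ρ
  have hσ : Function.Injective σ := Matrix.GeneralLinearGroup.toLin.injective.comp hρ
  have h := Module.End.prime_le_finrank_of_mul_eq_mul_mul hp (σ a) (σ b) (σ c)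
    (by simp only [← Units.val_mul, ← map_mul, hab]) (by simp only [← Units.val_mul, ← map_mul, hca])
    (by simp only [← Units.val_mul, ← map_mul, hcb])
    (by rw [← Units.val_pow_eq_pow_val, ← map_pow, hcp, map_one, Units.val_one])
    (by rw [Ne, Units.val_eq_one, map_eq_one_iff σ hσ]; exact hc)
  rw [Module.finrank_fin_fun] at h
  omega

end
end
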